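/- arXiv:2601.22435 — 2 statements merged into one kernel-verified Lean document; each statement's English description precedes it below -/
import Mathlib

section
/- If 𝕂 is a computable age, then EmbedInfo(𝕂) ≤_T 0'. Further, if 𝕂 is a uniformly finite computable age, then EmbedInfo(𝕂) is computable. -/
/- Self-contained framework for computable ages and cofinal Fraïssé limits. -/

namespace CFL

open Classical

/-! ### Oracle computability -/

/-- The characteristic partial function of a set of naturals. -/
noncomputable def chi (A : Set ℕ) : ℕ →. ℕ :=
  fun n => Part.some (if n ∈ A then 1 else 0)

/-- Codes for oracle partial recursive functions. -/
inductive OCode : Type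
  | zero : OCode
  | succ : OCode
  | left : OCode
  | right : OCode
  | oracle : OCode
  | pair : OCode → OCode → OCode
  | comp : OCode → OCode → OCode
  | prec : OCode → OCode → OCode
  | rfind' : OCode → OCode

/-- Evaluation of an oracle code relative to an oracle `O`. -/
def OCode.eval (O : ℕ →. ℕ) : OCode → ℕ →. ℕ
  | OCode.zero => pure 0
  | OCode.succ => Nat.succ
  | OCode.left => ↑fun n : ℕ => n.unpair.1
  | OCode.right => ↑fun n : ℕ => n.unpair.2
  | OCode.oracle => O
  | OCode.pair cf cg => fun n => Nat.pair <$> OCode.eval O cf n <*> OCode.eval O cg n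
  | OCode.comp cf cg => fun n => OCode.eval O cg n >>= OCode.eval O cf
  | OCode.prec cf cg =>
    Nat.unpaired fun a n =>
      n.rec (OCode.eval O cf a) fun y IH => do
        let i ← IH
        OCode.eval O cg (Nat.pair a (Nat.pair y i))
  | OCode.rfind' cf =>
    Nat.unpaired fun a m =>
      (Nat.rfind fun n => (fun m => m = 0) <$> OCode.eval O cf (Nat.pair a (n + m))).map
        (· + m)

/-- A numerical code of an `OCode`. -/
def OCode.encodeCode : OCode → ℕ
  | OCode.zero => 0
  | OCode.succ => 1
  | OCode.left => 2
  | OCode.right => 3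
  | OCode.oracle => 4
  | OCode.pair cf cg => 4 * Nat.pair cf.encodeCode cg.encodeCode + 5
  | OCode.comp cf cg => 4 * Nat.pair cf.encodeCode cg.encodeCode + 6
  | OCode.prec cf cg => 4 * Nat.pair cf.encodeCode cg.encodeCode + 7
  | OCode.rfind' cf => 4 * cf.encodeCode + 8

/-- `f` is a partial function recursive in the oracle set `O`. -/
def RecFunIn (O : Set ℕ) (f : ℕ →. ℕ) : Prop :=
  ∃ c : OCode, OCode.eval (chi O) c = f

/-- The code `c` computes the total function `f` relative to the oracle set `O`. -/
def ComputesIn (O : Set ℕ) (c : OCode) (f : ℕ → ℕ) : Prop :=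
  ∀ n, OCode.eval (chi O) c n = Part.some (f n)

/-- `f` is a total function computable in the oracle set `O`. -/
def TotalComputableIn (O : Set ℕ) (f : ℕ → ℕ) : Prop :=
  ∃ c : OCode, ComputesIn O c f

/-- The set `A` is computable in the oracle set `O`. -/
def SetRecIn (O A : Set ℕ) : Prop := RecFunIn O (chi A)

/-- Turing reducibility (on sets of naturals, regarded as representatives of
Turing degrees). -/
def TuringLE (A B : Set ℕ) : Prop := SetRecIn B A

/-- The set `A` is computably enumerable in the oracle set `O`. -/
def CEIn (O A : Set ℕ) : Prop :=
  ∃ c : OCode, ∀ n, n ∈ A ↔ (OCode.eval (chi O) c n).Dom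

/-- The Turing jump of a set of naturals. -/
def jump (O : Set ℕ) : Set ℕ :=
  { e | ∃ c : OCode, c.encodeCode = (Nat.unpair e).1 ∧
      (OCode.eval (chi O) c (Nat.unpair e).2).Dom }

/-- `0'`, the jump of the least degree. -/
def zeroJump : Set ℕ := jump ∅

/-- `0''`. -/
def zeroJump2 : Set ℕ := jump zeroJump

/-- `0'''`. -/
def zeroJump3 : Set ℕ := jump zeroJump2

/-! ### Languages and structures -/

/-- A (coded) first-order language: `relArity r = some k` means that `r` is the code of a
relation symbol of arity `k`, and similarly for function symbols. -/
structure Lang where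
  relArity : ℕ → Option ℕ
  funArity : ℕ → Option ℕ

/-- The language is computably represented. -/
def Lang.ComputableRep (L : Lang) : Prop :=
  TotalComputableIn ∅ (fun r => Encodable.encode (L.relArity r)) ∧
  TotalComputableIn ∅ (fun f => Encodable.encode (L.funArity f))

/-- A finite relational language. -/
def Lang.FiniteRelational (L : Lang) : Prop :=
  (∀ f, L.funArity f = none) ∧ { r | (L.relArity r).isSome = true }.Finite

/-- A finite language. -/
def Lang.FiniteLang (L : Lang) : Prop :=
  { r | (L.relArity r).isSome = true }.Finite ∧
  { f | (L.funArity f).isSome = true }.Finite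

/-- An `L`-structure with underlying set a set of naturals. -/
structure Str (L : Lang) where
  dom : Set ℕ
  rel : ℕ → List ℕ → Prop
  fn : ℕ → List ℕ → ℕ
  rel_valid : ∀ r as, rel r as → L.relArity r = some as.length ∧ ∀ x ∈ as, x ∈ dom
  fn_mem : ∀ f as, L.funArity f = some as.length → (∀ x ∈ as, x ∈ dom) → fn f as ∈ dom

variable {L : Lang}

/-- The (finite) tuple `as` lies in the structure `A`. -/
def TupleIn (A : Str L) (as : List ℕ) : Prop := ∀ x ∈ as, x ∈ A.dom

/-- Membership in the substructure of `A` generated by the tuple `s`. -/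
inductive InClosure (A : Str L) (s : List ℕ) : ℕ → Prop
  | base {x : ℕ} : x ∈ s → x ∈ A.dom → InClosure A s x
  | fn (f : ℕ) (as : List ℕ) : L.funArity f = some as.length →
      (∀ x ∈ as, InClosure A s x) → InClosure A s (A.fn f as)

theorem InClosure.mem_dom {A : Str L} {s : List ℕ} {x : ℕ}
    (h : InClosure A s x) : x ∈ A.dom := by
  induction h with
  | base _ hx => exact hx
  | fn f as ha _ ih => exact A.fn_mem f as ha ih

/-- The substructure of `A` generated by the tuple `s`. -/
def Str.sub (A : Str L) (s : List ℕ) : Str L where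
  dom := { x | InClosure A s x }
  rel r as := A.rel r as ∧ ∀ x ∈ as, InClosure A s x
  fn := A.fn
  rel_valid := fun r as h => ⟨(A.rel_valid r as h.1).1, h.2⟩
  fn_mem := fun f as ha hm => InClosure.fn f as ha hm

/-- `h` is an embedding of `A` into `B`. -/
def IsEmbMap (A B : Str L) (h : ℕ → ℕ) : Prop :=
  (∀ x ∈ A.dom, h x ∈ B.dom) ∧
  (∀ x ∈ A.dom, ∀ y ∈ A.dom, h x = h y → x = y) ∧
  (∀ r as, TupleIn A as → (A.rel r as ↔ B.rel r (as.map h))) ∧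
  (∀ f as, L.funArity f = some as.length → TupleIn A as →
    h (A.fn f as) = B.fn f (as.map h))

/-- `A` embeds into `B`. -/
def Embeds (A B : Str L) : Prop := ∃ h, IsEmbMap A B h

/-- `h` is an isomorphism of `A` onto `B`. -/
def IsIsoMap (A B : Str L) (h : ℕ → ℕ) : Prop :=
  IsEmbMap A B h ∧ ∀ y ∈ B.dom, ∃ x ∈ A.dom, h x = y

/-- `A` and `B` are isomorphic. -/
def Isom (A B : Str L) : Prop := ∃ h, IsIsoMap A B h

/-- `as ∼cl bs`: the coordinatewise map extends to an isomorphism of generated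
substructures. -/
def ClSim (A : Str L) (as : List ℕ) (B : Str L) (bs : List ℕ) : Prop :=
  ∃ h : ℕ → ℕ, as.map h = bs ∧ IsIsoMap (A.sub as) (B.sub bs) h

/-- `as ∼tuple bs`: equal length and the same pattern of equalities among coordinates. -/
def TupleSim (as bs : List ℕ) : Prop :=
  ∃ h h' : ℕ → ℕ, as.map h = bs ∧ bs.map h' = as

/-- `A` is finitely generated. -/
def Str.FG (A : Str L) : Prop :=
  ∃ s : List ℕ, TupleIn A s ∧ ∀ x, x ∈ A.dom ↔ InClosure A s x

/-- `g` is an automorphism of `M`. -/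
def IsAutoOf (M : Str L) (g : ℕ → ℕ) : Prop := IsIsoMap M M g

/-! ### Ages (as isomorphism-closed classes) -/

/-- `B` belongs to the age of `M`, i.e. `B` is isomorphic to a finitely generated
substructure of `M`. -/
def AgeMemOf (M : Str L) (B : Str L) : Prop :=
  ∃ as : List ℕ, TupleIn M as ∧ Isom B (M.sub as)

/-- The age of a structure `M`. -/
def ageOf (M : Str L) : Set (Str L) := { B | AgeMemOf M B }

/-- The hereditary property. -/
def HP (C : Set (Str L)) : Prop :=
  ∀ B ∈ C, ∀ as : List ℕ, TupleIn B as → B.sub as ∈ C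

/-- The joint embedding property. -/
def JEP (C : Set (Str L)) : Prop :=
  ∀ A ∈ C, ∀ B ∈ C, ∃ D ∈ C, Embeds A D ∧ Embeds B D

/-- Every pair of embeddings with domain `A` into members of `C` can be amalgamated
over `A` inside `C`. -/
def AmalgamatesOver (C : Set (Str L)) (A : Str L) : Prop :=
  ∀ B₀ ∈ C, ∀ B₁ ∈ C, ∀ f₀ f₁ : ℕ → ℕ, IsEmbMap A B₀ f₀ → IsEmbMap A B₁ f₁ →
    ∃ D ∈ C, ∃ g₀ g₁ : ℕ → ℕ, IsEmbMap B₀ D g₀ ∧ IsEmbMap B₁ D g₁ ∧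
      ∀ x ∈ A.dom, g₀ (f₀ x) = g₁ (f₁ x)

/-- The amalgamation property. -/
def AP (C : Set (Str L)) : Prop := ∀ A ∈ C, AmalgamatesOver C A

/-- `A` is an amalgamation base of the class `C`. -/
def AmalgBase (C : Set (Str L)) (A : Str L) : Prop := A ∈ C ∧ AmalgamatesOver C A

/-- The cofinal amalgamation property. -/
def CoAP (C : Set (Str L)) : Prop :=
  ∀ A ∈ C, ∃ A' : Str L, AmalgBase C A' ∧ Embeds A A'

/-! ### Computable ages -/

/-- An (abstract) enumerated age: for each index `i`, a generating tuple `tup i` and the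
structure `str i` it generates. -/
structure CompAge (L : Lang) where
  tup : ℕ → List ℕ
  str : ℕ → Str L
  tup_mem : ∀ i, TupleIn (str i) (tup i)
  gen : ∀ i x, x ∈ (str i).dom ↔ InClosure (str i) (tup i) x

/-- The class of structures represented by the enumerated age `K`. -/
def CompAge.cls (K : CompAge L) : Set (Str L) := { B | ∃ i, Isom B (K.str i) }

/-- The structure `M` is computable in the oracle set `s`. -/
def StrComputableIn (s : Set ℕ) (M : Str L) : Prop :=
  SetRecIn s M.dom ∧
  SetRecIn s { p | ∃ r as, TupleIn M as ∧ M.rel r as ∧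
      p = Nat.pair r (Encodable.encode as) } ∧
  SetRecIn s { p | ∃ f as b, L.funArity f = some as.length ∧ TupleIn M as ∧
      M.fn f as = b ∧ p = Nat.pair f (Nat.pair (Encodable.encode as) b) }

/-- The coded diagram of an enumerated age. -/
def CompAge.diag (K : CompAge L) : Set ℕ :=
  { p | ∃ i, p = Nat.pair 0 (Nat.pair i (Encodable.encode (K.tup i))) } ∪
  { p | ∃ i x, x ∈ (K.str i).dom ∧ p = Nat.pair 1 (Nat.pair i x) } ∪
  { p | ∃ i r as, TupleIn (K.str i) as ∧ (K.str i).rel r as ∧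
      p = Nat.pair 2 (Nat.pair i (Nat.pair r (Encodable.encode as))) } ∪
  { p | ∃ i r as, TupleIn (K.str i) as ∧ L.relArity r = some as.length ∧
      ¬ (K.str i).rel r as ∧
      p = Nat.pair 3 (Nat.pair i (Nat.pair r (Encodable.encode as))) } ∪
  { p | ∃ i f as b, TupleIn (K.str i) as ∧ L.funArity f = some as.length ∧
      (K.str i).fn f as = b ∧
      p = Nat.pair 4 (Nat.pair i (Nat.pair f (Nat.pair (Encodable.encode as) b))) }

/-- `K` is an `s`-computable age: its diagram is c.e. in `s` and each of its structures
is computable in `s`. -/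
def AgeComputableIn (s : Set ℕ) (K : CompAge L) : Prop :=
  CEIn s K.diag ∧ ∀ i, StrComputableIn s (K.str i)

/-- The embedding information of an enumerated age, as a set of naturals. -/
def EmbedInfo (K : CompAge L) : Set ℕ :=
  { p | ∃ k₀ b₀ k₁ b₁, TupleIn (K.str k₀) b₀ ∧ TupleIn (K.str k₁) b₁ ∧
      ClSim (K.str k₀) b₀ (K.str k₁) b₁ ∧
      p = Nat.pair k₀ (Nat.pair (Encodable.encode b₀)
            (Nat.pair k₁ (Encodable.encode b₁))) }

/-! ### Potential embeddings, spans, and amalgamation diagrams -/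

/-- A potential embedding: a pair of indices and a tuple in the codomain structure. -/
structure PotEmb where
  i : ℕ
  j : ℕ
  c : List ℕ

/-- A numerical code of a potential embedding. -/
def PotEmb.code (F : PotEmb) : ℕ :=
  Nat.pair F.i (Nat.pair F.j (Encodable.encode F.c))

/-- The potential embedding is well-formed with respect to `K`. -/
def PotEmb.Valid (K : CompAge L) (F : PotEmb) : Prop :=
  F.c.length = (K.tup F.i).length ∧ TupleIn (K.str F.j) F.c

/-- The potential embedding is an embedding. -/
def PotEmb.IsEmb (K : CompAge L) (F : PotEmb) : Prop :=
  ClSim (K.str F.i) (K.tup F.i) (K.str F.j) F.c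

/-- The potential embedding is an isomorphism (its range generates the codomain). -/
def PotEmb.IsIso (K : CompAge L) (F : PotEmb) : Prop :=
  F.IsEmb K ∧ ∀ x ∈ (K.str F.j).dom, InClosure (K.str F.j) F.c x

/-- `h` realizes the potential embedding `F` as a map on the domain structure. -/
def ExtMap (K : CompAge L) (F : PotEmb) (h : ℕ → ℕ) : Prop :=
  (K.tup F.i).map h = F.c ∧ IsEmbMap (K.str F.i) (K.str F.j) h

/-- `(F₀, F₁)` is a potential span. -/
def PotSpan (K : CompAge L) (F₀ F₁ : PotEmb) : Prop :=
  F₀.Valid K ∧ F₁.Valid K ∧ F₀.i = F₁.i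

/-- `(G₀, G₁)` is an amalgamation diagram over the potential span `(F₀, F₁)`. -/
def AmalgDiagOver (K : CompAge L) (F₀ F₁ G₀ G₁ : PotEmb) : Prop :=
  G₀.Valid K ∧ G₁.Valid K ∧ G₀.IsEmb K ∧
  G₀.i = F₀.j ∧ G₁.i = F₁.j ∧ G₀.j = G₁.j ∧
  (F₀.IsEmb K → F₁.IsEmb K → G₁.IsEmb K ∧
    ∀ h₀ h₁ : ℕ → ℕ, ExtMap K G₀ h₀ → ExtMap K G₁ h₁ →
      F₀.c.map h₀ = F₁.c.map h₁)

/-- `H` is the composition `F ∘ G` of potential embeddings (where `F` is an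
embedding realized by any `h` extending it). -/
def CompRel (K : CompAge L) (F G H : PotEmb) : Prop :=
  G.j = F.i ∧ H.i = G.i ∧ H.j = F.j ∧
  ∀ h : ℕ → ℕ, ExtMap K F h → H.c = G.c.map h

/-! ### Computable versions of HP, JEP, AP, coAP -/

/-- The `s`-computable hereditary property. -/
def CHP (s : Set ℕ) (K : CompAge L) : Prop :=
  ∃ c : OCode, ∀ i (b : List ℕ), TupleIn (K.str i) b →
    ∃ j, OCode.eval (chi s) c (Nat.pair i (Encodable.encode b)) = Part.some j ∧
      ClSim (K.str j) (K.tup j) (K.str i) b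

/-- The `s`-computable joint embedding property. -/
def CJEP (s : Set ℕ) (K : CompAge L) : Prop :=
  ∃ c : OCode, ∀ i j : ℕ, ∃ F G : PotEmb,
    OCode.eval (chi s) c (Nat.pair i j) = Part.some (Nat.pair F.code G.code) ∧
    F.Valid K ∧ G.Valid K ∧ F.IsEmb K ∧ G.IsEmb K ∧
    F.i = i ∧ G.i = j ∧ F.j = G.j

/-- The `s`-computable amalgamation property. -/
def CAP (s : Set ℕ) (K : CompAge L) : Prop :=
  ∃ c : OCode, ∀ F₀ F₁ : PotEmb, PotSpan K F₀ F₁ →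
    ∃ G₀ G₁ : PotEmb,
      OCode.eval (chi s) c (Nat.pair F₀.code F₁.code) =
        Part.some (Nat.pair G₀.code G₁.code) ∧
      AmalgDiagOver K F₀ F₁ G₀ G₁

/-- A family `W` of distinguished embeddings with amalgamation-base codomains, closed
under pre/post composition with isomorphisms, covering all domains. -/
def IsCoAPFamily (K : CompAge L) (W : Set PotEmb) : Prop :=
  (∀ F ∈ W, F.Valid K ∧ F.IsEmb K ∧ AmalgBase K.cls (K.str F.j)) ∧
  (∀ F ∈ W, ∀ G H : PotEmb, G.Valid K → G.IsIso K → G.j = F.i →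
      CompRel K F G H → H ∈ W) ∧
  (∀ F ∈ W, ∀ G H : PotEmb, G.Valid K → G.IsIso K → G.i = F.j →
      CompRel K G F H → H ∈ W) ∧
  (∀ i : ℕ, ∃ F ∈ W, F.i = i)

/-- The `s`-computable cofinal amalgamation property: there is an `s`-c.e. family of
distinguished embeddings onto amalgamation bases together with an `s`-computable
amalgamation function. -/
def CcoAP (s : Set ℕ) (K : CompAge L) : Prop :=
  ∃ W : Set PotEmb, IsCoAPFamily K W ∧
    CEIn s { p | ∃ F ∈ W, p = F.code } ∧
    ∃ c : OCode, ∀ F ∈ W, ∀ G₀ G₁ : PotEmb,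
      G₀.Valid K → G₁.Valid K → G₀.i = F.j → G₁.i = F.j →
      ∃ D₀ D₁ : PotEmb,
        OCode.eval (chi s) c (Nat.pair F.code (Nat.pair G₀.code G₁.code)) =
          Part.some (Nat.pair D₀.code D₁.code) ∧
        AmalgDiagOver K G₀ G₁ D₀ D₁

/-! ### Ultrahomogeneity -/

/-- `M` is ultrahomogeneous: every isomorphism between finitely generated substructures
extends to an automorphism. -/
def Ultrahomogeneous (M : Str L) : Prop :=
  ∀ as bs : List ℕ, TupleIn M as → TupleIn M bs → ClSim M as M bs →
    ∃ g : ℕ → ℕ, IsAutoOf M g ∧ as.map g = bs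

/-- `g` is a bijection of the underlying set of `M` with itself. -/
def BijOnDom (M : Str L) (g : ℕ → ℕ) : Prop :=
  (∀ x ∈ M.dom, g x ∈ M.dom) ∧
  (∀ x ∈ M.dom, ∀ y ∈ M.dom, g x = g y → x = y) ∧
  (∀ y ∈ M.dom, ∃ x ∈ M.dom, g x = y)

/-- `M` is `s`-computably ultrahomogeneous. -/
def CompUltrahom (s : Set ℕ) (M : Str L) : Prop :=
  ∃ c : OCode, ∀ as bs : List ℕ, TupleIn M as → TupleIn M bs →
    as.length = bs.length →
    ∃ e : ℕ,
      OCode.eval (chi s) c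
          (Nat.pair (Encodable.encode as) (Encodable.encode bs)) = Part.some e ∧
      ∃ c' : OCode, c'.encodeCode = e ∧ ∃ g : ℕ → ℕ, ComputesIn s c' g ∧
        BijOnDom M g ∧
        (ClSim M as M bs → IsAutoOf M g ∧ as.map g = bs)

/-! ### Cofinal ultrahomogeneity -/

/-- `M` is cofinally ultrahomogeneous. -/
def CofinallyUltrahomogeneous (M : Str L) : Prop :=
  ∀ as : List ℕ, TupleIn M as → ∃ bs : List ℕ, TupleIn M bs ∧
    (∀ x ∈ as, InClosure M bs x) ∧
    ∀ cs : List ℕ, TupleIn M cs → ClSim M bs M cs →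
      ∃ g : ℕ → ℕ, IsAutoOf M g ∧ bs.map g = cs

/-- `E` is a cofinal collection of tuples in `M`. -/
def IsCofinalCollection (M : Str L) (E : Set (List ℕ)) : Prop :=
  (∀ bs ∈ E, TupleIn M bs) ∧
  (∀ as : List ℕ, TupleIn M as → ∃ bs ∈ E, ∀ x ∈ as, InClosure M bs x) ∧
  (∀ bs ∈ E, ∀ as : List ℕ, (∀ x ∈ as, InClosure M bs x) → (as ++ bs) ∈ E) ∧
  (∀ as ∈ E, ∀ bs : List ℕ, TupleIn M bs → ClSim M as M bs → bs ∈ E)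

/-- `M` is cofinally ultrahomogeneous for the collection `E`: every isomorphism between
substructures generated by members of `E` extends to an automorphism. -/
def CofUltraFor (M : Str L) (E : Set (List ℕ)) : Prop :=
  ∀ as ∈ E, ∀ bs ∈ E, ClSim M as M bs →
    ∃ g : ℕ → ℕ, IsAutoOf M g ∧ as.map g = bs

/-- The set of codes of members of `E`. -/
def ECodes (E : Set (List ℕ)) : Set ℕ := { p | ∃ as ∈ E, p = Encodable.encode as }

/-- The functional part of `s`-computable cofinal ultrahomogeneity with respect to `E`. -/
def CofUltraFunIn (s : Set ℕ) (M : Str L) (E : Set (List ℕ)) : Prop :=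
  ∃ c : OCode, ∀ as ∈ E, ∀ bs : List ℕ, TupleIn M bs → TupleSim as bs →
    ∃ e : ℕ,
      OCode.eval (chi s) c
          (Nat.pair (Encodable.encode as) (Encodable.encode bs)) = Part.some e ∧
      ∃ c' : OCode, c'.encodeCode = e ∧ ∃ g : ℕ → ℕ, ComputesIn s c' g ∧
        BijOnDom M g ∧ as.map g = bs ∧
        (ClSim M as M bs → IsAutoOf M g)

/-- `M` is `s`-computably cofinally ultrahomogeneous with respect to `E`. -/
def CompCofUltrahomWrt (s : Set ℕ) (M : Str L) (E : Set (List ℕ)) : Prop :=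
  IsCofinalCollection M E ∧ SetRecIn s (ECodes E) ∧ CofUltraFunIn s M E

/-- `M` is `s`-computably cofinally ultrahomogeneous. -/
def CompCofUltrahom (s : Set ℕ) (M : Str L) : Prop :=
  ∃ E : Set (List ℕ), CompCofUltrahomWrt s M E

/-- The `s`-computable cofinal extension property with respect to `E`. -/
def CompCofExtProp (s : Set ℕ) (M : Str L) (E : Set (List ℕ)) : Prop :=
  ∃ c : OCode, ∀ as bs cs : List ℕ, as ∈ E → cs ∈ E → TupleIn M bs →
    (∀ x ∈ as, InClosure M cs x) → TupleSim as bs →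
    ∃ ds : List ℕ,
      OCode.eval (chi s) c
          (Nat.pair (Encodable.encode as)
            (Nat.pair (Encodable.encode bs) (Encodable.encode cs))) =
        Part.some (Encodable.encode ds) ∧
      TupleIn M ds ∧ TupleSim (as ++ cs) (bs ++ ds) ∧
      (ClSim M as M bs →
        ClSim M ds M cs ∧ (∀ x ∈ bs, InClosure M ds x) ∧
        ∀ h h' : ℕ → ℕ,
          ds.map h = cs → IsIsoMap (M.sub ds) (M.sub cs) h →
          bs.map h' = as → IsIsoMap (M.sub bs) (M.sub as) h' →
          bs.map h = bs.map h')

/-! ### Canonical ages and limits -/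

/-- `K` is a canonical age of `M` (relative to the oracle `t`): the enumeration of
generating tuples is `t`-computable, lists every finite tuple of `M` infinitely often,
and `str i` is the substructure generated by `tup i`. -/
def IsCanonicalAgeOf (t : Set ℕ) (K : CompAge L) (M : Str L) : Prop :=
  TotalComputableIn t (fun i => Encodable.encode (K.tup i)) ∧
  (∀ i, TupleIn M (K.tup i)) ∧
  (∀ as : List ℕ, TupleIn M as → ∀ n : ℕ, ∃ i, n ≤ i ∧ K.tup i = as) ∧
  (∀ i, K.str i = M.sub (K.tup i))

/-- `K` represents the age of `M`. -/
def RepresentsAgeOf (K : CompAge L) (M : Str L) : Prop :=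
  (∀ i, AgeMemOf M (K.str i)) ∧
  (∀ B : Str L, AgeMemOf M B → ∃ i, Isom B (K.str i))

/-- `M` is a cofinal Fraïssé limit of (the age represented by) `K`. -/
def CofinalFraisseLimitOf (K : CompAge L) (M : Str L) : Prop :=
  CofinallyUltrahomogeneous M ∧ RepresentsAgeOf K M

/-- The enumerated age `K` is uniformly finite. -/
def UniformlyFinite (K : CompAge L) : Prop :=
  L.FiniteLang ∧ ∃ f : ℕ → ℕ, TotalComputableIn ∅ f ∧
    ∀ i, ∀ as : List ℕ, TupleIn (K.str i) as →
      { x | InClosure (K.str i) as x }.Finite ∧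
      { x | InClosure (K.str i) as x }.ncard ≤ f as.length


/-! ### Oracle codes and partial recursive functions -/

theorem OCode.exists_eval_eq (O : ℕ →. ℕ) {f : ℕ →. ℕ} (hf : Nat.Partrec f) :
    ∃ c : OCode, c.eval O = f := by
  induction hf with
  | zero => exact ⟨.zero, rfl⟩
  | succ => exact ⟨.succ, rfl⟩
  | left => exact ⟨.left, rfl⟩
  | right => exact ⟨.right, rfl⟩
  | pair _ _ ihf ihg =>
    obtain ⟨cf, rfl⟩ := ihf
    obtain ⟨cg, rfl⟩ := ihg
    exact ⟨.pair cf cg, rfl⟩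
  | comp _ _ ihf ihg =>
    obtain ⟨cf, rfl⟩ := ihf
    obtain ⟨cg, rfl⟩ := ihg
    exact ⟨.comp cf cg, rfl⟩
  | prec _ _ ihf ihg =>
    obtain ⟨cf, rfl⟩ := ihf
    obtain ⟨cg, rfl⟩ := ihg
    exact ⟨.prec cf cg, rfl⟩
  | rfind _ ihf =>
    obtain ⟨cf, rfl⟩ := ihf
    refine ⟨.comp (.rfind' cf) (.pair (.pair .left .right) .zero), ?_⟩
    funext a
    simp [OCode.eval, Seq.seq, pure, PFun.pure, Nat.unpaired]
    exact Part.map_id' (fun _ => rfl) _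

theorem OCode.partrec_eval {O : ℕ →. ℕ} (hO : Nat.Partrec O) (c : OCode) :
    Nat.Partrec (c.eval O) := by
  induction c with
  | zero => exact Nat.Partrec.zero
  | succ => exact Nat.Partrec.succ
  | left => exact Nat.Partrec.left
  | right => exact Nat.Partrec.right
  | oracle => exact hO
  | pair _ _ ihf ihg => exact ihf.pair ihg
  | comp _ _ ihf ihg => exact ihf.comp ihg
  | prec _ _ ihf ihg => exact ihf.prec ihg
  | rfind' _ ihf => exact ihf.rfind'

theorem partrec_chi_empty : Nat.Partrec (chi ∅) := by
  have : chi ∅ = fun _ => Part.some 0 := by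
    funext n
    simp [chi]
  rw [this]
  exact Nat.Partrec.of_primrec (f := fun _ => 0) (Nat.Primrec.const 0)

theorem OCode.encodeCode_injective : Function.Injective OCode.encodeCode := by
  intro c
  induction c with
  | zero | succ | left | right | oracle =>
    intro d h
    cases d <;> simp [OCode.encodeCode] at h ⊢
  | pair a b iha ihb | comp a b iha ihb | prec a b iha ihb =>
    intro d h
    cases d <;> simp only [OCode.encodeCode] at h <;> try omega
    rename_i a' b'
    have h' : Nat.pair a.encodeCode b.encodeCode = Nat.pair a'.encodeCode b'.encodeCode := by
      omega
    rw [Nat.pair_eq_pair] at h'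
    rw [iha h'.1, ihb h'.2]
  | rfind' a iha =>
    intro d h
    cases d <;> simp only [OCode.encodeCode] at h <;> try omega
    rename_i a'
    rw [@iha a' (by omega)]

/-! ### Primitive recursive functions -/

attribute [fun_prop] Primrec

@[fun_prop]
theorem primrec_id {α : Type} [Primcodable α] : Primrec fun a : α => a := Primrec.id

@[fun_prop]
theorem primrec_const {α β : Type} [Primcodable α] [Primcodable β] (b : β) :
    Primrec fun _ : α => b := Primrec.const b

@[fun_prop]
theorem primrec_comp {α β γ : Type} [Primcodable α] [Primcodable β] [Primcodable γ]
    {f : β → γ} {g : α → β} (hf : Primrec f) (hg : Primrec g) : Primrec fun a => f (g a) :=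
  hf.comp hg

section Primrec

variable {α β γ : Type} [Primcodable α] [Primcodable β] [Primcodable γ]

@[fun_prop]
theorem primrec_fst {f : α → β × γ} (hf : Primrec f) : Primrec fun a => (f a).1 :=
  Primrec.fst.comp hf

@[fun_prop]
theorem primrec_snd {f : α → β × γ} (hf : Primrec f) : Primrec fun a => (f a).2 :=
  Primrec.snd.comp hf

@[fun_prop]
theorem primrec_prodMk {f : α → β} {g : α → γ} (hf : Primrec f) (hg : Primrec g) :
    Primrec fun a => (f a, g a) :=
  hf.pair hg

@[fun_prop]
theorem primrec_range {f : α → ℕ} (hf : Primrec f) : Primrec fun a => List.range (f a) :=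
  Primrec.list_range.comp hf

@[fun_prop]
theorem primrec_length {f : α → List β} (hf : Primrec f) : Primrec fun a => (f a).length :=
  Primrec.list_length.comp hf

@[fun_prop]
theorem primrec_some {f : α → β} (hf : Primrec f) : Primrec fun a => some (f a) :=
  Primrec.option_some.comp hf

@[fun_prop]
theorem primrec_getElem? {f : α → List β} {g : α → ℕ} (hf : Primrec f) (hg : Primrec g) :
    Primrec fun a => (f a)[g a]? :=
  Primrec.list_getElem?.comp hf hg

@[fun_prop]
theorem primrec_encode {f : α → β} (hf : Primrec f) : Primrec fun a => Encodable.encode (f a) :=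
  Primrec.encode.comp hf

@[fun_prop]
theorem primrec_natPair {f g : α → ℕ} (hf : Primrec f) (hg : Primrec g) :
    Primrec fun a => Nat.pair (f a) (g a) :=
  Primrec₂.natPair.comp hf hg

@[fun_prop]
theorem primrec_map_fst {f : α → List (β × γ)} (hf : Primrec f) :
    Primrec fun a => (f a).map Prod.fst :=
  Primrec.list_map hf (Primrec.fst.comp Primrec.snd).to₂

@[fun_prop]
theorem primrec_map_snd {f : α → List (β × γ)} (hf : Primrec f) :
    Primrec fun a => (f a).map Prod.snd :=
  Primrec.list_map hf (Primrec.snd.comp Primrec.snd).to₂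

end Primrec

/-! ### Sigma-one predicates -/

/-- A predicate is `SigmaOne` if it is the union of an increasing sequence of uniformly
primitive recursive predicates. -/
def SigmaOne {α : Type} [Primcodable α] (p : α → Prop) : Prop :=
  ∃ R : α → ℕ → Prop, PrimrecRel R ∧ (∀ a m n, m ≤ n → R a m → R a n) ∧
    ∀ a, p a ↔ ∃ n, R a n

theorem _root_.PrimrecRel.exists_mem {α β : Type} [Primcodable α] [Primcodable β]
    {R : α → β → Prop} {l : α → List β} (hR : PrimrecRel R) (hl : Primrec l) :
    PrimrecPred fun a => ∃ b ∈ l a, R a b :=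
  (PrimrecRel.exists_mem_list (R := fun b a => R a b)
    (hR.comp Primrec.snd Primrec.fst)).comp hl Primrec.id

theorem _root_.PrimrecRel.forall_mem {α β : Type} [Primcodable α] [Primcodable β]
    {R : α → β → Prop} {l : α → List β} (hR : PrimrecRel R) (hl : Primrec l) :
    PrimrecPred fun a => ∀ b ∈ l a, R a b :=
  (PrimrecRel.forall_mem_list (R := fun b a => R a b)
    (hR.comp Primrec.snd Primrec.fst)).comp hl Primrec.id

namespace SigmaOne

variable {α β : Type} [Primcodable α] [Primcodable β]

theorem of_eq {p q : α → Prop} (hp : SigmaOne p) (h : ∀ a, p a ↔ q a) : SigmaOne q :=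
  (funext fun a => propext (h a) : p = q) ▸ hp

theorem of_primrecPred {p : α → Prop} (hp : PrimrecPred p) : SigmaOne p :=
  ⟨fun a _ => p a, hp.comp Primrec.fst, fun _ _ _ _ h => h, fun _ => by simp⟩

theorem comp {p : β → Prop} {f : α → β} (hp : SigmaOne p) (hf : Primrec f) :
    SigmaOne fun a => p (f a) := by
  obtain ⟨R, hR, hm, h⟩ := hp
  exact ⟨fun a n => R (f a) n, hR.comp (hf.comp Primrec.fst) Primrec.snd,
    fun a => hm (f a), fun a => h (f a)⟩

theorem and {p q : α → Prop} (hp : SigmaOne p) (hq : SigmaOne q) :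
    SigmaOne fun a => p a ∧ q a := by
  obtain ⟨R, hR, hRm, hRp⟩ := hp
  obtain ⟨S, hS, hSm, hSq⟩ := hq
  refine ⟨fun a n => R a n ∧ S a n, PrimrecPred.and hR hS,
    fun a m n h => And.imp (hRm a m n h) (hSm a m n h), fun a => ?_⟩
  beta_reduce
  rw [hRp, hSq]
  refine ⟨fun ⟨⟨m, hm⟩, n, hn⟩ => ⟨max m n, hRm a _ _ (le_max_left m n) hm,
    hSm a _ _ (le_max_right m n) hn⟩, fun ⟨n, hr, hs⟩ => ⟨⟨n, hr⟩, n, hs⟩⟩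

theorem or {p q : α → Prop} (hp : SigmaOne p) (hq : SigmaOne q) :
    SigmaOne fun a => p a ∨ q a := by
  obtain ⟨R, hR, hRm, hRp⟩ := hp
  obtain ⟨S, hS, hSm, hSq⟩ := hq
  refine ⟨fun a n => R a n ∨ S a n, PrimrecPred.or hR hS,
    fun a m n h => Or.imp (hRm a m n h) (hSm a m n h), fun a => ?_⟩
  beta_reduce
  rw [hRp, hSq, exists_or]

theorem exists_mem {p : α → β → Prop} {l : α → List β} (hp : SigmaOne fun q : α × β => p q.1 q.2)
    (hl : Primrec l) : SigmaOne fun a => ∃ b ∈ l a, p a b := by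
  obtain ⟨R, hR, hRm, hRp⟩ := hp
  refine ⟨fun a n => ∃ b ∈ l a, R (a, b) n, ?_, ?_, fun a => ?_⟩
  · exact PrimrecRel.exists_mem (α := α × ℕ) (R := fun x b => R (x.1, b) x.2)
      (hR.comp ((Primrec.fst.comp Primrec.fst).pair Primrec.snd)
        (Primrec.snd.comp Primrec.fst)) (hl.comp Primrec.fst)
  · rintro a m n h ⟨b, hb, hr⟩
    exact ⟨b, hb, hRm _ _ _ h hr⟩
  · have hRp (b : β) : p a b ↔ ∃ n, R (a, b) n := hRp (a, b)
    simp only [hRp]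
    exact ⟨fun ⟨b, hb, n, h⟩ => ⟨n, b, hb, h⟩, fun ⟨n, b, hb, h⟩ => ⟨b, hb, n, h⟩⟩

theorem forall_mem {p : α → β → Prop} {l : α → List β} (hp : SigmaOne fun q : α × β => p q.1 q.2)
    (hl : Primrec l) : SigmaOne fun a => ∀ b ∈ l a, p a b := by
  obtain ⟨R, hR, hRm, hRp⟩ := hp
  refine ⟨fun a n => ∀ b ∈ l a, R (a, b) n, ?_, ?_, fun a => ?_⟩
  · exact PrimrecRel.forall_mem (α := α × ℕ) (R := fun x b => R (x.1, b) x.2)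
      (hR.comp ((Primrec.fst.comp Primrec.fst).pair Primrec.snd)
        (Primrec.snd.comp Primrec.fst)) (hl.comp Primrec.fst)
  · exact fun a m n h hr b hb => hRm _ _ _ h (hr b hb)
  · have hRp (b : β) : p a b ↔ ∃ n, R (a, b) n := hRp (a, b)
    simp only [hRp]
    refine ⟨fun h => ?_, fun ⟨n, h⟩ b hb => ⟨n, h b hb⟩⟩
    generalize l a = l at h
    induction l with
    | nil => exact ⟨0, by simp⟩
    | cons b l ih =>
      obtain ⟨m, hm⟩ := h b (by simp)
      obtain ⟨n, hn⟩ := ih fun c hc => h c (by simp [hc])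
      refine ⟨max m n, fun c hc => ?_⟩
      rcases List.mem_cons.1 hc with rfl | hc
      · exact hRm _ _ _ (le_max_left m n) hm
      · exact hRm _ _ _ (le_max_right m n) (hn c hc)

theorem exists_val {p : α → β → Prop} (hp : SigmaOne fun q : α × β => p q.1 q.2) :
    SigmaOne fun a => ∃ b, p a b := by
  obtain ⟨R, hR, hRm, hRp⟩ := hp
  refine ⟨fun a n => ∃ b ∈ (List.range n).filterMap (Encodable.decode (α := β)), R (a, b) n,
    ?_, ?_, fun a => ?_⟩
  · exact PrimrecRel.exists_mem (α := α × ℕ) (R := fun x b => R (x.1, b) x.2)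
      (hR.comp ((Primrec.fst.comp Primrec.fst).pair Primrec.snd)
        (Primrec.snd.comp Primrec.fst))
      (Primrec.listFilterMap (Primrec.list_range.comp Primrec.snd)
        (Primrec.decode.comp Primrec.snd))
  · rintro a m n h ⟨b, hb, hr⟩
    refine ⟨b, ?_, hRm _ _ _ h hr⟩
    simp only [List.mem_filterMap, List.mem_range] at hb ⊢
    obtain ⟨i, hi, hd⟩ := hb
    exact ⟨i, hi.trans_le h, hd⟩
  · have hRp (b : β) : p a b ↔ ∃ n, R (a, b) n := hRp (a, b)
    simp only [hRp, List.mem_filterMap, List.mem_range]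
    refine ⟨fun ⟨b, n, h⟩ => ?_, fun ⟨n, b, _, h⟩ => ⟨b, n, h⟩⟩
    exact ⟨max n (Encodable.encode b + 1), b,
      ⟨Encodable.encode b, by omega, Encodable.encodek b⟩, hRm _ _ _ (le_max_left _ _) h⟩

theorem of_partrec {f : ℕ →. ℕ} (hf : Nat.Partrec f) : SigmaOne fun n => (f n).Dom := by
  obtain ⟨c, rfl⟩ := Nat.Partrec.Code.exists_code.1 hf
  refine ⟨fun n k => Nat.Partrec.Code.evaln k c n ≠ none, ?_, ?_, fun n => ?_⟩
  · exact PrimrecPred.not (Primrec.eq.comp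
      (Nat.Partrec.Code.primrec_evaln.comp
        ((Primrec.snd.pair (Primrec.const c)).pair Primrec.fst)) (Primrec.const none))
  · intro n k k' h
    simp only [Option.ne_none_iff_exists']
    exact fun ⟨x, hx⟩ => ⟨x, Nat.Partrec.Code.evaln_mono h hx⟩
  · simp only [Option.ne_none_iff_exists', Part.dom_iff_mem, Nat.Partrec.Code.evaln_complete]
    exact exists_comm

theorem rePred {p : α → Prop} (hp : SigmaOne p) : REPred p := by
  obtain ⟨R, hR, -, hRp⟩ := hp
  have hR : Primrec₂ fun a n => decide (R a n) := hR.decide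
  refine (REPred.of_eq (p := fun a => (Nat.rfind fun n => Part.some (decide (R a n))).Dom)
    ?_ fun a => ?_)
  · exact Partrec.dom_re (Partrec.rfind (p := fun a n => Part.some (decide (R a n))) hR.to_comp)
  · rw [hRp]
    refine (Nat.rfind_dom (p := fun n => Part.some (decide (R a n)))).trans ?_
    simp

end SigmaOne

theorem CEIn.sigmaOne {A : Set ℕ} (hA : CEIn ∅ A) : SigmaOne fun n => n ∈ A := by
  obtain ⟨c, hc⟩ := hA
  exact (SigmaOne.of_partrec (c.partrec_eval partrec_chi_empty)).of_eq fun n => (hc n).symm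

theorem SetRecIn.of_sigmaOne {A : Set ℕ} (O : Set ℕ) (h : SigmaOne fun n => n ∈ A)
    (h' : SigmaOne fun n => n ∉ A) : SetRecIn O A := by
  obtain ⟨_, hA⟩ := ComputablePred.computable_iff_re_compl_re'.2 ⟨h.rePred, h'.rePred⟩
  have : Computable fun n => if n ∈ A then 1 else 0 :=
    (Computable.cond hA (Computable.const 1) (Computable.const 0)).of_eq fun n => by
      by_cases hn : n ∈ A <;> simp [hn]
  exact OCode.exists_eval_eq _ (Partrec.nat_iff.1 (this.partrec.of_eq fun n => by simp [chi]))

theorem SigmaOne.exists_mem_zeroJump_iff {p : ℕ → Prop} (h : SigmaOne p) :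
    ∃ e : ℕ, ∀ n, p n ↔ Nat.pair e n ∈ zeroJump := by
  have h' : Nat.Partrec fun n => (Part.assert (p n) fun _ => Part.some ()).map fun _ => 0 :=
    Partrec.nat_iff.1 (h.rePred.map (Computable.const 0).to₂)
  obtain ⟨c, hc⟩ := OCode.exists_eval_eq (chi ∅) h'
  refine ⟨c.encodeCode, fun n => ?_⟩
  simp only [zeroJump, jump, Set.mem_ofPred_eq, Nat.unpair_pair]
  constructor
  · exact fun hn => ⟨c, rfl, by rw [hc]; exact ⟨hn, trivial⟩⟩
  · rintro ⟨d, hd, hn⟩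
    rw [OCode.encodeCode_injective hd, hc] at hn
    exact hn.1

theorem turingLE_zeroJump_of_sigmaOne {A : Set ℕ} {p q : ℕ → Prop} (hp : SigmaOne p)
    (hq : SigmaOne q) (hA : ∀ n, n ∈ A ↔ p n ∧ ¬ q n) : TuringLE A zeroJump := by
  obtain ⟨a, ha⟩ := hp.exists_mem_zeroJump_iff
  obtain ⟨b, hb⟩ := hq.exists_mem_zeroJump_iff
  have hpair (e : ℕ) : Nat.Partrec fun n => Part.some (Nat.pair e n) :=
    Partrec.nat_iff.1 (Primrec₂.natPair.comp (Primrec.const e) Primrec.id).to_comp.partrec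
  have hsub : Nat.Partrec fun n => Part.some (n.unpair.1 - n.unpair.2) :=
    Partrec.nat_iff.1 (Primrec.nat_sub.comp (Primrec.fst.comp Primrec.unpair)
      (Primrec.snd.comp Primrec.unpair)).to_comp.partrec
  obtain ⟨ca, hca⟩ := OCode.exists_eval_eq (chi zeroJump) (hpair a)
  obtain ⟨cb, hcb⟩ := OCode.exists_eval_eq (chi zeroJump) (hpair b)
  obtain ⟨cs, hcs⟩ := OCode.exists_eval_eq (chi zeroJump) hsub
  refine ⟨.comp cs (.pair (.comp .oracle ca) (.comp .oracle cb)), ?_⟩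
  have hbind (f : ℕ →. ℕ) (x : ℕ) : (Part.some x >>= f) = f x := Part.bind_some x f
  funext n
  by_cases h₁ : p n <;> by_cases h₂ : q n <;>
    simp [OCode.eval, hbind, hca, hcb, hcs, chi, hA, ← ha, ← hb, h₁, h₂, Seq.seq]

/-! ### Finitary generation -/

section Generation

variable {α β : Type}

/-- The set generated by a system `S` of finitary rules, where `S ws z` means that `z` may be
inferred from the list `ws` of premises. -/
inductive Generated (S : List β → β → Prop) : β → Prop
  | infer {ws : List β} {z : β} : S ws z → (∀ w ∈ ws, Generated S w) → Generated S z

/-- Every entry of the list `l` is inferred from earlier entries. -/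
def IsDerivation (S : List β → β → Prop) (l : List β) : Prop :=
  ∀ i ∈ List.range l.length, ∃ q : List β × β, l[i]? = some q.2 ∧ S q.1 q.2 ∧
    ∀ w ∈ q.1, ∃ j ∈ List.range i, l[j]? = some w

theorem IsDerivation.append {S : List β → β → Prop} {l l' : List β} (h : IsDerivation S l)
    (h' : IsDerivation S l') : IsDerivation S (l ++ l') := by
  intro i hi
  simp only [List.mem_range, List.length_append] at hi
  by_cases hil : i < l.length
  · obtain ⟨q, hq, hS, hw⟩ := h i (List.mem_range.2 hil)
    refine ⟨q, by rw [List.getElem?_append_left hil, hq], hS, fun w hw' => ?_⟩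
    obtain ⟨j, hj, hjw⟩ := hw w hw'
    exact ⟨j, hj, by rw [List.getElem?_append_left ((List.mem_range.1 hj).trans hil), hjw]⟩
  · obtain ⟨q, hq, hS, hw⟩ := h' (i - l.length) (List.mem_range.2 (by omega))
    refine ⟨q, by rw [List.getElem?_append_right (by omega), hq], hS, fun w hw' => ?_⟩
    obtain ⟨j, hj, hjw⟩ := hw w hw'
    rw [List.mem_range] at hj
    exact ⟨j + l.length, List.mem_range.2 (by omega), by
      rw [List.getElem?_append_right (by omega), Nat.add_sub_cancel, hjw]⟩

theorem IsDerivation.generated {S : List β → β → Prop} {l : List β} (h : IsDerivation S l)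
    {z : β} (hz : z ∈ l) : Generated S z := by
  obtain ⟨i, hi⟩ := List.mem_iff_getElem?.1 hz
  induction i using Nat.strong_induction_on generalizing z with
  | _ i ih =>
    obtain ⟨q, hq, hS, hw⟩ := h i (List.mem_range.2 (List.getElem?_eq_some_iff.1 hi).1)
    obtain rfl : q.2 = z := by rw [hq] at hi; exact Option.some.inj hi
    refine .infer hS fun w hw' => ?_
    obtain ⟨j, hj, hjw⟩ := hw w hw'
    exact ih j (List.mem_range.1 hj) (List.mem_of_getElem? hjw) hjw

theorem Generated.exists_isDerivation {S : List β → β → Prop} {z : β} (h : Generated S z) :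
    ∃ l, IsDerivation S l ∧ z ∈ l := by
  induction h with
  | @infer ws z hS _ ih =>
    have : ∃ l, IsDerivation S l ∧ ∀ w ∈ ws, w ∈ l := by
      clear hS
      induction ws with
      | nil => exact ⟨[], by simp [IsDerivation], by simp⟩
      | cons w ws ihw =>
        obtain ⟨l, hl, hwl⟩ := ih w (by simp)
        obtain ⟨l', hl', hwl'⟩ := ihw (fun v hv => by simp_all) (fun v hv => ih v (by simp [hv]))
        refine ⟨l ++ l', hl.append hl', fun v hv => ?_⟩
        rcases List.mem_cons.1 hv with rfl | hv
        · simp [hwl]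
        · simp [hwl' v hv]
    obtain ⟨l, hl, hwl⟩ := this
    refine ⟨l ++ [z], fun i hi => ?_, by simp⟩
    simp only [List.mem_range, List.length_append, List.length_singleton] at hi
    by_cases hil : i < l.length
    · obtain ⟨q, hq, hS, hw⟩ := hl i (List.mem_range.2 hil)
      refine ⟨q, by rw [List.getElem?_append_left hil, hq], hS, fun w hw' => ?_⟩
      obtain ⟨j, hj, hjw⟩ := hw w hw'
      exact ⟨j, hj, by rw [List.getElem?_append_left ((List.mem_range.1 hj).trans hil), hjw]⟩
    · obtain rfl : i = l.length := by omega
      refine ⟨(ws, z), by simp, hS, fun w hw => ?_⟩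
      obtain ⟨j, hj⟩ := List.mem_iff_getElem?.1 (hwl w hw)
      have hjl := (List.getElem?_eq_some_iff.1 hj).1
      exact ⟨j, List.mem_range.2 hjl, by rw [List.getElem?_append_left hjl, hj]⟩

theorem generated_iff_exists_isDerivation {S : List β → β → Prop} {z : β} :
    Generated S z ↔ ∃ l, IsDerivation S l ∧ z ∈ l :=
  ⟨Generated.exists_isDerivation, fun ⟨_, h, hz⟩ => h.generated hz⟩

theorem SigmaOne.generated [Primcodable α] [Primcodable β] {S : α → List β → β → Prop}
    (hS : SigmaOne fun q : α × List β × β => S q.1 q.2.1 q.2.2) :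
    SigmaOne fun q : α × β => Generated (S q.1) q.2 := by
  simp only [generated_iff_exists_isDerivation]
  refine .exists_val (.and (.forall_mem (.exists_val (.and ?_ (.and ?_
    (.forall_mem (.exists_mem ?_ ?_) ?_)))) ?_) ?_)
  · exact .of_primrecPred (Primrec.eq.comp (by fun_prop) (by fun_prop))
  · exact hS.comp (f := fun s : (((α × β) × List β) × ℕ) × (List β × β) => (s.1.1.1.1, s.2))
      (by fun_prop)
  · exact .of_primrecPred (Primrec.eq.comp (by fun_prop) (by fun_prop))
  · fun_prop
  · fun_prop
  · fun_prop
  · exact (SigmaOne.exists_mem (p := fun (q : (α × β) × List β) z => z = q.1.2) (l := Prod.snd)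
      (.of_primrecPred (Primrec.eq.comp (by fun_prop) (by fun_prop))) (by fun_prop)).of_eq (by simp)

end Generation

/-! ### Linked pairs -/

/-- The graph of the interpretation of the function symbol `f` in `A`. -/
def FnGraph (A : Str L) (f : ℕ) (as : List ℕ) (b : ℕ) : Prop :=
  TupleIn A as ∧ L.funArity f = some as.length ∧ A.fn f as = b

/-- The relation symbol `r` holds of the tuple `as` in `A`. -/
def Holds (A : Str L) (r : ℕ) (as : List ℕ) : Prop := TupleIn A as ∧ A.rel r as

/-- The relation symbol `r` has the right arity for the tuple `as` in `A`, and fails of it. -/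
def Fails (A : Str L) (r : ℕ) (as : List ℕ) : Prop :=
  TupleIn A as ∧ L.relArity r = some as.length ∧ ¬ A.rel r as

/-- The rules generating the graph of the isomorphism which extends `as ↦ bs`. -/
def PairRule (A : Str L) (as : List ℕ) (B : Str L) (bs : List ℕ) (ws : List (ℕ × ℕ))
    (z : ℕ × ℕ) : Prop :=
  (∃ i : ℕ, as[i]? = some z.1 ∧ bs[i]? = some z.2) ∨
    ∃ f, FnGraph A f (ws.map Prod.fst) z.1 ∧ FnGraph B f (ws.map Prod.snd) z.2

/-- The pairs of values taken in `A` at `as` and in `B` at `bs` by a common term. -/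
def Linked (A : Str L) (as : List ℕ) (B : Str L) (bs : List ℕ) : ℕ × ℕ → Prop :=
  Generated (PairRule A as B bs)

/-- An atomic formula which is true of one of the tuples `as`, `bs` and false of the other. -/
def Clash (A : Str L) (as : List ℕ) (B : Str L) (bs : List ℕ) : Prop :=
  as.length ≠ bs.length ∨
  (∃ z z' : ℕ × ℕ, Linked A as B bs z ∧ Linked A as B bs z' ∧ ¬ (z.1 = z'.1 ↔ z.2 = z'.2)) ∨
  ∃ (r : ℕ) (ws : List (ℕ × ℕ)), (∀ w ∈ ws, Linked A as B bs w) ∧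
    (Holds A r (ws.map Prod.fst) ∧ Fails B r (ws.map Prod.snd) ∨
      Fails A r (ws.map Prod.fst) ∧ Holds B r (ws.map Prod.snd))

section Linked

variable {A B : Str L} {as bs : List ℕ}

theorem Linked.swap {z : ℕ × ℕ} (h : Linked A as B bs z) : Linked B bs A as z.swap := by
  induction h with
  | @infer ws z hS _ ih =>
    refine .infer (ws := ws.map Prod.swap) ?_ (List.forall_mem_map.2 ih)
    rcases hS with ⟨i, h₁, h₂⟩ | ⟨f, h₁, h₂⟩
    · exact .inl ⟨i, h₂, h₁⟩
    · exact .inr ⟨f, by simpa [Function.comp_def] using h₂, by simpa [Function.comp_def] using h₁⟩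

theorem Linked.inClosure_fst (ha : TupleIn A as) {z : ℕ × ℕ} (h : Linked A as B bs z) :
    InClosure A as z.1 := by
  induction h with
  | @infer ws z hS _ ih =>
    rcases hS with ⟨i, h₁, -⟩ | ⟨f, ⟨-, hf, h₁⟩, -⟩
    · exact .base (List.mem_of_getElem? h₁) (ha _ (List.mem_of_getElem? h₁))
    · rw [← h₁]
      exact .fn f _ hf (by simpa using fun a b => ih (a, b))

theorem Linked.inClosure_snd (hb : TupleIn B bs) {z : ℕ × ℕ} (h : Linked A as B bs z) :
    InClosure B bs z.2 :=
  h.swap.inClosure_fst hb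

theorem Linked.fn (ha : TupleIn A as) (hb : TupleIn B bs) {f : ℕ} {ws : List (ℕ × ℕ)}
    (hf : L.funArity f = some ws.length) (hw : ∀ w ∈ ws, Linked A as B bs w) :
    Linked A as B bs (A.fn f (ws.map Prod.fst), B.fn f (ws.map Prod.snd)) := by
  refine .infer (.inr ⟨f, ⟨?_, by simpa using hf, rfl⟩, ?_, by simpa using hf, rfl⟩) hw
  · simpa [TupleIn] using fun x y h => ((hw (x, y) h).inClosure_fst ha).mem_dom
  · simpa [TupleIn] using fun x y h => ((hw (y, x) h).inClosure_snd hb).mem_dom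

theorem exists_map_fst_eq {p : ℕ × ℕ → Prop} {l : List ℕ} (h : ∀ x ∈ l, ∃ y, p (x, y)) :
    ∃ ws : List (ℕ × ℕ), ws.map Prod.fst = l ∧ ∀ w ∈ ws, p w := by
  choose! g hg using h
  exact ⟨l.map fun x => (x, g x), by simp [Function.comp_def], by simpa using hg⟩

theorem InClosure.exists_linked (ha : TupleIn A as) (hb : TupleIn B bs)
    (hl : as.length = bs.length) {x : ℕ} (h : InClosure A as x) :
    ∃ y, Linked A as B bs (x, y) := by
  induction h with
  | base hx =>
    obtain ⟨i, hi⟩ := List.mem_iff_getElem?.1 hx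
    have hib : i < bs.length := hl ▸ (List.getElem?_eq_some_iff.1 hi).1
    exact ⟨bs[i], .infer (ws := []) (.inl ⟨i, hi, List.getElem?_eq_getElem hib⟩) (by simp)⟩
  | fn f l hf _ ih =>
    obtain ⟨ws, rfl, hw⟩ := exists_map_fst_eq (p := Linked A as B bs) ih
    exact ⟨_, .fn ha hb (by simpa using hf) hw⟩

theorem ClSim.not_clash (ha : TupleIn A as) (hb : TupleIn B bs) (h : ClSim A as B bs) :
    ¬ Clash A as B bs := by
  obtain ⟨h, rfl, ⟨-, hinj, hrel, hfn⟩, -⟩ := h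
  have key {z : ℕ × ℕ} (hz : Linked A as B (as.map h) z) : z.2 = h z.1 := by
    have hz' := hz
    induction hz with
    | @infer ws z hS hw ih =>
      have hws : ws.map Prod.snd = (ws.map Prod.fst).map h := by
        simpa using fun x y hxy => ih (x, y) hxy (hw _ hxy)
      rcases hS with ⟨i, h₁, h₂⟩ | ⟨f, ⟨-, hf, h₁⟩, -, -, h₂⟩
      · simpa [h₁, eq_comm] using h₂
      · rw [← h₁, ← h₂, hws]
        refine (hfn f _ hf ?_).symm
        exact List.forall_mem_map.2 fun w hw' => Linked.inClosure_fst ha (hw w hw')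
  rintro (hl | ⟨z, z', hz, hz', hne⟩ | ⟨r, ws, hw, hr⟩)
  · simp at hl
  · refine hne ⟨fun he => by rw [key hz, key hz', he], fun he => ?_⟩
    rw [key hz, key hz'] at he
    exact hinj _ (hz.inClosure_fst ha) _ (hz'.inClosure_fst ha) he
  · have hcl : ∀ x ∈ ws.map Prod.fst, InClosure A as x :=
      List.forall_mem_map.2 fun w hw' => (hw w hw').inClosure_fst ha
    have hws : ws.map Prod.snd = (ws.map Prod.fst).map h := by
      simpa using fun x y hxy => key (hw (x, y) hxy)
    have := hrel r _ hcl
    rw [← hws] at this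
    rcases hr with ⟨⟨-, h₁⟩, -, -, h₂⟩ | ⟨⟨-, -, h₁⟩, -, h₂⟩
    · exact h₂ (this.1 ⟨h₁, hcl⟩).1
    · refine h₁ (this.2 ⟨h₂, ?_⟩).1
      rw [hws]
      refine List.forall_mem_map.2 fun x hx => ?_
      obtain ⟨w, hw', rfl⟩ := List.mem_map.1 hx
      rw [← key (hw w hw')]
      exact (hw w hw').inClosure_snd hb

theorem rel_iff_rel_of_not_clash (ha : TupleIn A as) (hb : TupleIn B bs)
    (h : ¬ Clash A as B bs) {r : ℕ} {ws : List (ℕ × ℕ)} (hw : ∀ w ∈ ws, Linked A as B bs w) :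
    A.rel r (ws.map Prod.fst) ↔ B.rel r (ws.map Prod.snd) := by
  have h₁ : TupleIn A (ws.map Prod.fst) :=
    List.forall_mem_map.2 fun w hw' => ((hw w hw').inClosure_fst ha).mem_dom
  have h₂ : TupleIn B (ws.map Prod.snd) :=
    List.forall_mem_map.2 fun w hw' => ((hw w hw').inClosure_snd hb).mem_dom
  by_contra hne
  refine h (.inr (.inr ⟨r, ws, hw, ?_⟩))
  by_cases hA : A.rel r (ws.map Prod.fst)
  · have har := (A.rel_valid r _ hA).1
    exact .inl ⟨⟨h₁, hA⟩, h₂, by simpa using har, by tauto⟩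
  · have hB : B.rel r (ws.map Prod.snd) := by tauto
    have har := (B.rel_valid r _ hB).1
    exact .inr ⟨⟨h₁, by simpa using har, hA⟩, h₂, hB⟩

theorem ClSim.of_not_clash (ha : TupleIn A as) (hb : TupleIn B bs) (hc : ¬ Clash A as B bs) :
    ClSim A as B bs := by
  have hl : as.length = bs.length := by
    by_contra hl
    exact hc (.inl hl)
  have hinj {z z' : ℕ × ℕ} (hz : Linked A as B bs z) (hz' : Linked A as B bs z') :
      z.1 = z'.1 ↔ z.2 = z'.2 := by
    by_contra hne
    exact hc (.inr (.inl ⟨z, z', hz, hz', hne⟩))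
  have hex (x : ℕ) (hx : InClosure A as x) : ∃ y, Linked A as B bs (x, y) :=
    hx.exists_linked ha hb hl
  choose! h hh using hex
  have hval {z : ℕ × ℕ} (hz : Linked A as B bs z) : h z.1 = z.2 :=
    (hinj (hh _ (hz.inClosure_fst ha)) hz).1 rfl
  have hmap {l : List ℕ} (hx : ∀ x ∈ l, InClosure A as x) :
      ∀ w ∈ l.map (fun x => (x, h x)), Linked A as B bs w :=
    List.forall_mem_map.2 fun x hx' => hh x (hx x hx')
  refine ⟨h, ?_, ⟨?_, ?_, ?_, ?_⟩, ?_⟩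
  · refine List.ext_getElem (by simpa using hl) fun i hi hi' => ?_
    rw [List.length_map] at hi
    rw [List.getElem_map]
    exact hval (z := (as[i], bs[i])) (.infer (ws := [])
      (.inl ⟨i, List.getElem?_eq_getElem hi, List.getElem?_eq_getElem hi'⟩) (by simp))
  · exact fun x hx => (hh x hx).inClosure_snd hb
  · exact fun x hx y hy he => (hinj (hh x hx) (hh y hy)).2 he
  · intro r l hx
    have := rel_iff_rel_of_not_clash (r := r) ha hb hc (hmap hx)
    simp only [List.map_map, Function.comp_def, List.map_id'] at this
    refine and_congr this ⟨fun _ => ?_, fun _ => hx⟩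
    exact List.forall_mem_map.2 fun x hx' => (hh x (hx x hx')).inClosure_snd hb
  · intro f l hf hx
    have := hval (Linked.fn (f := f) ha hb (by simpa using hf) (hmap hx))
    simp only [List.map_map, Function.comp_def, List.map_id'] at this
    exact this
  · intro y hy
    obtain ⟨x, hx⟩ := InClosure.exists_linked hb ha hl.symm hy
    exact ⟨x, hx.swap.inClosure_fst ha, hval hx.swap⟩

end Linked

/-! ### Enumerating tuples -/

/-- The list of all tuples of length `n` with entries in the list `D`. -/
def tuples {β : Type} (D : List β) (n : ℕ) : List (List β) :=
  Nat.rec [[]] (fun _ T => D.flatMap fun d => T.map fun l => d :: l) n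

theorem mem_tuples {β : Type} {D : List β} {n : ℕ} {l : List β} :
    l ∈ tuples D n ↔ l.length = n ∧ ∀ x ∈ l, x ∈ D := by
  induction n generalizing l with
  | zero => cases l <;> simp [tuples]
  | succ n ih =>
    change (l ∈ D.flatMap fun d => (tuples D n).map fun l => d :: l) ↔ _
    cases l with
    | nil => simp
    | cons d l =>
      simp only [List.mem_flatMap, List.mem_map, List.cons.injEq, ih, List.length_cons,
        Nat.add_right_cancel_iff, List.forall_mem_cons]
      constructor
      · rintro ⟨_, hd, _, ⟨hl, hD⟩, rfl, rfl⟩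
        exact ⟨hl, hd, hD⟩
      · rintro ⟨hl, hd, hD⟩
        exact ⟨d, hd, l, ⟨hl, hD⟩, rfl, rfl⟩

@[fun_prop]
theorem primrec_tuples {α β : Type} [Primcodable α] [Primcodable β] {D : α → List β} {n : α → ℕ}
    (hD : Primrec D) (hn : Primrec n) : Primrec fun a => tuples (D a) (n a) := by
  refine Primrec.nat_rec' (g := fun _ => [[]])
    (h := fun a q => (D a).flatMap fun d => q.2.map fun l => d :: l) hn (Primrec.const _) ?_
  refine Primrec.list_flatMap (hD.comp Primrec.fst)
    (Primrec.list_map (f := fun q : (α × ℕ × List (List β)) × β => q.1.2.2)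
      (g := fun q l => q.2 :: l) (by fun_prop) ?_).to₂
  exact (Primrec.list_cons.comp (Primrec.snd.comp Primrec.fst) Primrec.snd).to₂

theorem exists_list_forall_mem_iff {a : ℕ → Option ℕ}
    (h : { r | (a r).isSome = true }.Finite) :
    ∃ F : List (ℕ × ℕ), ∀ q : ℕ × ℕ, q ∈ F ↔ a q.1 = some q.2 := by
  refine ⟨h.toFinset.toList.filterMap fun r => (a r).map fun n => (r, n), fun ⟨f, n⟩ => ?_⟩
  simp only [List.mem_filterMap, Finset.mem_toList, Set.Finite.mem_toFinset, Set.mem_ofPred_eq,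
    Option.map_eq_some_iff, Prod.mk.injEq]
  constructor
  · rintro ⟨_, -, _, h, rfl, rfl⟩
    exact h
  · exact fun h => ⟨f, by simp [h], n, h, rfl, rfl⟩

/-! ### Finite certificates -/

/-- The list `D` is the graph of an isomorphism extending `as ↦ bs`, where `F` and `R` list the
function and relation symbols with their arities. -/
def IsIsoGraph (F R : List (ℕ × ℕ)) (A : Str L) (as : List ℕ) (B : Str L) (bs : List ℕ)
    (D : List (ℕ × ℕ)) : Prop :=
  (∀ i ∈ List.range as.length, ∃ z ∈ D, as[i]? = some z.1 ∧ bs[i]? = some z.2) ∧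
  (∀ f ∈ F, ∀ ws ∈ tuples D f.2, ∃ z ∈ D,
    FnGraph A f.1 (ws.map Prod.fst) z.1 ∧ FnGraph B f.1 (ws.map Prod.snd) z.2) ∧
  (∀ z ∈ D, ∀ z' ∈ D, z.1 = z'.1 ↔ z.2 = z'.2) ∧
  ∀ r ∈ R, ∀ ws ∈ tuples D r.2,
    Holds A r.1 (ws.map Prod.fst) ∧ Holds B r.1 (ws.map Prod.snd) ∨
      Fails A r.1 (ws.map Prod.fst) ∧ Fails B r.1 (ws.map Prod.snd)

/-- The list `D` contains `t` and is closed under the functions of `A`, where `F` lists the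
function symbols with their arities. -/
def IsClosedList (F : List (ℕ × ℕ)) (A : Str L) (t D : List ℕ) : Prop :=
  (∀ x ∈ t, ∃ y ∈ D, x = y) ∧
  ∀ f ∈ F, ∀ ws ∈ tuples D f.2, ∃ y ∈ D, FnGraph A f.1 ws y

section Certificates

variable {F R : List (ℕ × ℕ)} {A B : Str L} {as bs : List ℕ}

theorem IsIsoGraph.mem_of_linked {D : List (ℕ × ℕ)}
    (hF : ∀ q : ℕ × ℕ, L.funArity q.1 = some q.2 → q ∈ F)
    (h : IsIsoGraph F R A as B bs D) {z : ℕ × ℕ} (hz : Linked A as B bs z) : z ∈ D := by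
  induction hz with
  | @infer ws z hS _ ih =>
    rcases hS with ⟨i, h₁, h₂⟩ | ⟨f, ⟨-, hf, h₁⟩, -, -, h₂⟩
    · obtain ⟨w, hw, h₁', h₂'⟩ :=
        h.1 i (List.mem_range.2 (List.getElem?_eq_some_iff.1 h₁).1)
      rw [h₁, Option.some.injEq] at h₁'
      rw [h₂, Option.some.injEq] at h₂'
      exact (Prod.ext h₁' h₂' : z = w) ▸ hw
    · obtain ⟨w, hw, ⟨-, -, h₁'⟩, -, -, h₂'⟩ := h.2.1 (f, ws.length)
        (hF _ (by simpa using hf)) ws (mem_tuples.2 ⟨rfl, ih⟩)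
      exact (Prod.ext (h₁.symm.trans h₁') (h₂.symm.trans h₂') : z = w) ▸ hw

theorem IsIsoGraph.not_clash {D : List (ℕ × ℕ)} (hl : as.length = bs.length)
    (hF : ∀ q : ℕ × ℕ, q ∈ F ↔ L.funArity q.1 = some q.2)
    (hR : ∀ q : ℕ × ℕ, q ∈ R ↔ L.relArity q.1 = some q.2)
    (h : IsIsoGraph F R A as B bs D) : ¬ Clash A as B bs := by
  have key {z : ℕ × ℕ} (hz : Linked A as B bs z) : z ∈ D :=
    h.mem_of_linked (fun q => (hF q).2) hz
  rintro (hl' | ⟨z, z', hz, hz', hne⟩ | ⟨r, ws, hw, hr⟩)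
  · exact hl' hl
  · exact hne (h.2.2.1 z (key hz) z' (key hz'))
  · have har : L.relArity r = some ws.length := by
      rcases hr with ⟨-, -, h₁, -⟩ | ⟨⟨-, h₁, -⟩, -⟩ <;> simpa using h₁
    have := h.2.2.2 (r, ws.length) ((hR _).2 har) ws (mem_tuples.2 ⟨rfl, fun w h => key (hw w h)⟩)
    simp only [Holds, Fails] at this hr
    tauto

theorem exists_isIsoGraph (ha : TupleIn A as) (hb : TupleIn B bs)
    (hF : ∀ q : ℕ × ℕ, q ∈ F ↔ L.funArity q.1 = some q.2)
    (hR : ∀ q : ℕ × ℕ, q ∈ R ↔ L.relArity q.1 = some q.2)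
    (hfin : { x | InClosure A as x }.Finite) (h : ¬ Clash A as B bs) :
    ∃ D, IsIsoGraph F R A as B bs D := by
  have hl : as.length = bs.length := by
    by_contra hl
    exact h (.inl hl)
  have hinj (z z' : ℕ × ℕ) (hz : Linked A as B bs z) (hz' : Linked A as B bs z') :
      z.1 = z'.1 ↔ z.2 = z'.2 := by
    by_contra hne
    exact h (.inr (.inl ⟨z, z', hz, hz', hne⟩))
  have hDfin : { z | Linked A as B bs z }.Finite :=
    Set.Finite.of_finite_image (f := Prod.fst)
      (hfin.subset (Set.image_subset_iff.2 fun z hz => Linked.inClosure_fst ha hz))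
      fun z hz z' hz' he => Prod.ext he ((hinj z z' hz hz').1 he)
  have hmem (z : ℕ × ℕ) : z ∈ hDfin.toFinset.toList ↔ Linked A as B bs z := by simp
  refine ⟨hDfin.toFinset.toList, fun i hi => ?_, fun f hf ws hw => ?_, fun z hz z' hz' => ?_,
    fun r hr ws hw => ?_⟩
  · rw [List.mem_range] at hi
    have h₁ := List.getElem?_eq_getElem hi
    have h₂ := List.getElem?_eq_getElem (hl ▸ hi)
    exact ⟨(as[i], bs[i]), (hmem _).2 (.infer (ws := []) (.inl ⟨i, h₁, h₂⟩) (by simp)), h₁, h₂⟩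
  · simp only [mem_tuples, hmem] at hw
    have hf' : L.funArity f.1 = some ws.length := hw.1 ▸ (hF f).1 hf
    refine ⟨_, (hmem _).2 (.fn ha hb hf' hw.2), ⟨?_, by simpa using hf', rfl⟩, ?_,
      by simpa using hf', rfl⟩
    · exact List.forall_mem_map.2 fun w hw' => ((hw.2 w hw').inClosure_fst ha).mem_dom
    · exact List.forall_mem_map.2 fun w hw' => ((hw.2 w hw').inClosure_snd hb).mem_dom
  · exact hinj z z' ((hmem z).1 hz) ((hmem z').1 hz')
  · simp only [mem_tuples, hmem] at hw
    have hr' : L.relArity r.1 = some ws.length := hw.1 ▸ (hR r).1 hr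
    have := rel_iff_rel_of_not_clash ha hb h (r := r.1) hw.2
    have h₁ : TupleIn A (ws.map Prod.fst) :=
      List.forall_mem_map.2 fun w hw' => ((hw.2 w hw').inClosure_fst ha).mem_dom
    have h₂ : TupleIn B (ws.map Prod.snd) :=
      List.forall_mem_map.2 fun w hw' => ((hw.2 w hw').inClosure_snd hb).mem_dom
    simp only [Holds, Fails, List.length_map]
    tauto

theorem IsClosedList.mem_of_inClosure {t D : List ℕ}
    (hF : ∀ q : ℕ × ℕ, q ∈ F ↔ L.funArity q.1 = some q.2) (h : IsClosedList F A t D) {x : ℕ}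
    (hx : InClosure A t x) : x ∈ D := by
  induction hx with
  | base hx =>
    obtain ⟨y, hy, rfl⟩ := h.1 _ hx
    exact hy
  | fn f l hf _ ih =>
    obtain ⟨y, hy, -, -, rfl⟩ := h.2 (f, l.length) ((hF _).2 hf) l (mem_tuples.2 ⟨rfl, ih⟩)
    exact hy

theorem exists_isClosedList {t : List ℕ} (ht : TupleIn A t)
    (hF : ∀ q : ℕ × ℕ, q ∈ F ↔ L.funArity q.1 = some q.2)
    (hfin : { x | InClosure A t x }.Finite) :
    ∃ D, IsClosedList F A t D ∧ ∀ x ∈ D, InClosure A t x := by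
  have hmem (x : ℕ) : x ∈ hfin.toFinset.toList ↔ InClosure A t x := by simp
  refine ⟨hfin.toFinset.toList, ⟨fun x hx => ⟨x, (hmem x).2 (.base hx (ht x hx)), rfl⟩,
    fun f hf ws hw => ?_⟩, fun x => (hmem x).1⟩
  simp only [mem_tuples, hmem] at hw
  have hf' : L.funArity f.1 = some ws.length := hw.1 ▸ (hF f).1 hf
  exact ⟨_, (hmem _).2 (.fn f.1 ws hf' hw.2), fun x hx => (hw.2 x hx).mem_dom, hf', rfl⟩

end Certificates

/-! ### Complexity of the diagram -/

section Diagram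

variable {K : CompAge L} {α : Type} [Primcodable α] {k r x : α → ℕ} {l : α → List ℕ}

theorem SigmaOne.tup_eq (hK : SigmaOne fun n => n ∈ K.diag) (hk : Primrec k) (hl : Primrec l) :
    SigmaOne fun a => K.tup (k a) = l a :=
  (hK.comp (f := fun a => Nat.pair 0 (Nat.pair (k a) (Encodable.encode (l a))))
    (by fun_prop)).of_eq fun a => by simp [CompAge.diag, Nat.pair_eq_pair, eq_comm]

theorem SigmaOne.mem_dom (hK : SigmaOne fun n => n ∈ K.diag) (hk : Primrec k) (hx : Primrec x) :
    SigmaOne fun a => x a ∈ (K.str (k a)).dom :=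
  (hK.comp (f := fun a => Nat.pair 1 (Nat.pair (k a) (x a)))
    (by fun_prop)).of_eq fun a => by simp [CompAge.diag, Nat.pair_eq_pair]

theorem SigmaOne.holds (hK : SigmaOne fun n => n ∈ K.diag) (hk : Primrec k) (hr : Primrec r)
    (hl : Primrec l) : SigmaOne fun a => Holds (K.str (k a)) (r a) (l a) :=
  (hK.comp (f := fun a => Nat.pair 2 (Nat.pair (k a) (Nat.pair (r a) (Encodable.encode (l a)))))
    (by fun_prop)).of_eq fun a => by simp [CompAge.diag, Nat.pair_eq_pair, Holds]

theorem SigmaOne.fails (hK : SigmaOne fun n => n ∈ K.diag) (hk : Primrec k) (hr : Primrec r)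
    (hl : Primrec l) : SigmaOne fun a => Fails (K.str (k a)) (r a) (l a) :=
  (hK.comp (f := fun a => Nat.pair 3 (Nat.pair (k a) (Nat.pair (r a) (Encodable.encode (l a)))))
    (by fun_prop)).of_eq fun a => by simp [CompAge.diag, Nat.pair_eq_pair, Fails]

theorem SigmaOne.fnGraph (hK : SigmaOne fun n => n ∈ K.diag) (hk : Primrec k) (hr : Primrec r)
    (hl : Primrec l) (hx : Primrec x) :
    SigmaOne fun a => FnGraph (K.str (k a)) (r a) (l a) (x a) :=
  (hK.comp (f := fun a => Nat.pair 4 (Nat.pair (k a) (Nat.pair (r a)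
    (Nat.pair (Encodable.encode (l a)) (x a))))) (by fun_prop)).of_eq fun a => by
      simp [CompAge.diag, Nat.pair_eq_pair, FnGraph, eq_comm]

theorem SigmaOne.tupleIn (hK : SigmaOne fun n => n ∈ K.diag) (hk : Primrec k) (hl : Primrec l) :
    SigmaOne fun a => TupleIn (K.str (k a)) (l a) :=
  .forall_mem (hK.mem_dom (by fun_prop) (by fun_prop)) hl

theorem SigmaOne.linked (hK : SigmaOne fun n => n ∈ K.diag) {k' : α → ℕ} {l' : α → List ℕ}
    {z : α → ℕ × ℕ} (hk : Primrec k) (hl : Primrec l) (hk' : Primrec k') (hl' : Primrec l')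
    (hz : Primrec z) :
    SigmaOne fun a => Linked (K.str (k a)) (l a) (K.str (k' a)) (l' a) (z a) := by
  refine (SigmaOne.generated (S := fun a => PairRule (K.str (k a)) (l a) (K.str (k' a)) (l' a))
    (.or (.exists_val (.and ?_ ?_)) (.exists_val (.and ?_ ?_)))).comp
      (f := fun a => (a, z a)) (by fun_prop)
  · exact .of_primrecPred (Primrec.eq.comp (by fun_prop) (by fun_prop))
  · exact .of_primrecPred (Primrec.eq.comp (by fun_prop) (by fun_prop))
  · exact hK.fnGraph (by fun_prop) (by fun_prop) (by fun_prop) (by fun_prop)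
  · exact hK.fnGraph (by fun_prop) (by fun_prop) (by fun_prop) (by fun_prop)

theorem PrimrecPred.eq_iff_eq {k k' x x' : α → ℕ} (hk : Primrec k) (hk' : Primrec k')
    (hx : Primrec x) (hx' : Primrec x') : PrimrecPred fun a => k a = k' a ↔ x a = x' a := by
  have h₁ : PrimrecPred fun a => k a = k' a := Primrec.eq.comp hk hk'
  have h₂ : PrimrecPred fun a => x a = x' a := Primrec.eq.comp hx hx'
  exact ((h₁.and h₂).or (h₁.not.and h₂.not)).of_eq fun a => by tauto

theorem SigmaOne.clash (hK : SigmaOne fun n => n ∈ K.diag) {k' : α → ℕ} {l' : α → List ℕ}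
    (hk : Primrec k) (hl : Primrec l) (hk' : Primrec k') (hl' : Primrec l') :
    SigmaOne fun a => Clash (K.str (k a)) (l a) (K.str (k' a)) (l' a) := by
  refine .or (.of_primrecPred (PrimrecPred.not (Primrec.eq.comp (by fun_prop) (by fun_prop))))
    (.or (.exists_val (.exists_val (.and ?_ (.and ?_ (.of_primrecPred (.not ?_))))))
      (.exists_val (.exists_val (.and (.forall_mem ?_ ?_) (.or (.and ?_ ?_) (.and ?_ ?_))))))
  · exact hK.linked (by fun_prop) (by fun_prop) (by fun_prop) (by fun_prop) (by fun_prop)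
  · exact hK.linked (by fun_prop) (by fun_prop) (by fun_prop) (by fun_prop) (by fun_prop)
  · exact PrimrecPred.eq_iff_eq (by fun_prop) (by fun_prop) (by fun_prop) (by fun_prop)
  · exact hK.linked (by fun_prop) (by fun_prop) (by fun_prop) (by fun_prop) (by fun_prop)
  · fun_prop
  · exact hK.holds (by fun_prop) (by fun_prop) (by fun_prop)
  · exact hK.fails (by fun_prop) (by fun_prop) (by fun_prop)
  · exact hK.fails (by fun_prop) (by fun_prop) (by fun_prop)
  · exact hK.holds (by fun_prop) (by fun_prop) (by fun_prop)

theorem SigmaOne.isIsoGraph (hK : SigmaOne fun n => n ∈ K.diag) (F R : List (ℕ × ℕ))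
    {k' : α → ℕ} {l' : α → List ℕ} {D : α → List (ℕ × ℕ)} (hk : Primrec k) (hl : Primrec l)
    (hk' : Primrec k') (hl' : Primrec l') (hD : Primrec D) :
    SigmaOne fun a => IsIsoGraph F R (K.str (k a)) (l a) (K.str (k' a)) (l' a) (D a) := by
  refine .and (.forall_mem (.exists_mem (.and ?_ ?_) ?_) ?_)
    (.and (.forall_mem (.forall_mem (.exists_mem (.and ?_ ?_) ?_) ?_) ?_)
      (.and (.forall_mem (.forall_mem (.of_primrecPred ?_) ?_) ?_)
        (.forall_mem (.forall_mem (.or (.and ?_ ?_) (.and ?_ ?_)) ?_) ?_)))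
  · exact .of_primrecPred (Primrec.eq.comp (by fun_prop) (by fun_prop))
  · exact .of_primrecPred (Primrec.eq.comp (by fun_prop) (by fun_prop))
  · fun_prop
  · fun_prop
  · exact hK.fnGraph (by fun_prop) (by fun_prop) (by fun_prop) (by fun_prop)
  · exact hK.fnGraph (by fun_prop) (by fun_prop) (by fun_prop) (by fun_prop)
  · fun_prop
  · fun_prop
  · fun_prop
  · exact PrimrecPred.eq_iff_eq (by fun_prop) (by fun_prop) (by fun_prop) (by fun_prop)
  · fun_prop
  · fun_prop
  · exact hK.holds (by fun_prop) (by fun_prop) (by fun_prop)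
  · exact hK.holds (by fun_prop) (by fun_prop) (by fun_prop)
  · exact hK.fails (by fun_prop) (by fun_prop) (by fun_prop)
  · exact hK.fails (by fun_prop) (by fun_prop) (by fun_prop)
  · fun_prop
  · fun_prop

theorem SigmaOne.isClosedList (hK : SigmaOne fun n => n ∈ K.diag) (F : List (ℕ × ℕ))
    {D : α → List ℕ} (hk : Primrec k) (hl : Primrec l) (hD : Primrec D) :
    SigmaOne fun a => IsClosedList F (K.str (k a)) (l a) (D a) := by
  refine .and (.forall_mem (.exists_mem (.of_primrecPred ?_) ?_) ?_)
    (.forall_mem (.forall_mem (.exists_mem ?_ ?_) ?_) ?_)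
  · exact Primrec.eq.comp (by fun_prop) (by fun_prop)
  · fun_prop
  · fun_prop
  · exact hK.fnGraph (by fun_prop) (by fun_prop) (by fun_prop) (by fun_prop)
  · fun_prop
  · fun_prop
  · fun_prop

theorem SigmaOne.not_tupleIn (hK : SigmaOne fun n => n ∈ K.diag) {F : List (ℕ × ℕ)}
    (hF : ∀ q : ℕ × ℕ, q ∈ F ↔ L.funArity q.1 = some q.2)
    (hfin : ∀ i, { x | InClosure (K.str i) (K.tup i) x }.Finite)
    (hk : Primrec k) (hl : Primrec l) : SigmaOne fun a => ¬ TupleIn (K.str (k a)) (l a) := by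
  have : SigmaOne fun a => ∃ t, K.tup (k a) = t ∧ ∃ D, IsClosedList F (K.str (k a)) t D ∧
      ∃ x ∈ l a, ∀ y ∈ D, ¬ x = y := by
    refine .exists_val (.and ?_ (.exists_val (.and ?_ (.exists_mem (.forall_mem
      (.of_primrecPred (.not ?_)) ?_) ?_))))
    · exact hK.tup_eq (by fun_prop) (by fun_prop)
    · exact hK.isClosedList F (by fun_prop) (by fun_prop) (by fun_prop)
    · exact Primrec.eq.comp (by fun_prop) (by fun_prop)
    · fun_prop
    · fun_prop
  refine this.of_eq fun a => ⟨?_, fun h => ?_⟩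
  · rintro ⟨_, rfl, D, hD, x, hx, hxD⟩ ha
    exact hxD x (hD.mem_of_inClosure hF ((K.gen _ _).1 (ha x hx))) rfl
  · simp only [TupleIn, not_forall] at h
    obtain ⟨x, hx, hxd⟩ := h
    obtain ⟨D, hD, hDc⟩ := exists_isClosedList (K.tup_mem (k a)) hF (hfin (k a))
    refine ⟨_, rfl, D, hD, x, hx, ?_⟩
    rintro y hy rfl
    exact hxd (hDc _ hy).mem_dom

end Diagram

/-! ### Embedding information -/

theorem exists_primrec_forall_mem_embedInfo_iff (K : CompAge L) :
    ∃ (k₀ k₁ : ℕ → ℕ) (b₀ b₁ : ℕ → List ℕ),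
      (Primrec k₀ ∧ Primrec k₁ ∧ Primrec b₀ ∧ Primrec b₁) ∧ ∀ p, p ∈ EmbedInfo K ↔
        (TupleIn (K.str (k₀ p)) (b₀ p) ∧ TupleIn (K.str (k₁ p)) (b₁ p)) ∧
          ¬ Clash (K.str (k₀ p)) (b₀ p) (K.str (k₁ p)) (b₁ p) := by
  have hn : Primrec (Denumerable.ofNat (ℕ × List ℕ × ℕ × List ℕ)) := Primrec.ofNat _
  refine ⟨_, _, _, _, ⟨primrec_fst hn, primrec_fst (primrec_snd (primrec_snd hn)),
    primrec_fst (primrec_snd hn), primrec_snd (primrec_snd (primrec_snd hn))⟩, fun p => ?_⟩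
  have hp : Encodable.encode (Denumerable.ofNat (ℕ × List ℕ × ℕ × List ℕ) p) = p :=
    Denumerable.encode_ofNat p
  generalize Denumerable.ofNat (ℕ × List ℕ × ℕ × List ℕ) p = q at hp
  obtain ⟨k₀, b₀, k₁, b₁⟩ := q
  constructor
  · rintro ⟨k₀', b₀', k₁', b₁', h₀, h₁, h, he⟩
    obtain ⟨rfl, rfl, rfl, rfl⟩ : k₀ = k₀' ∧ b₀ = b₀' ∧ k₁ = k₁' ∧ b₁ = b₁' := by
      simpa [← hp, Nat.pair_eq_pair] using he
    exact ⟨⟨h₀, h₁⟩, h.not_clash h₀ h₁⟩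
  · rintro ⟨⟨h₀, h₁⟩, h⟩
    exact ⟨k₀, b₀, k₁, b₁, h₀, h₁, .of_not_clash h₀ h₁ h, by simpa using hp.symm⟩

/-- For a computable age `𝕂`, `EmbedInfo(𝕂) ≤_T 0'`; and if `𝕂` is
uniformly finite then `EmbedInfo(𝕂)` is computable. -/
theorem embedinfo_computable_from_jump {L : Lang} (hL : L.ComputableRep)
    (K : CompAge L) (hK : AgeComputableIn ∅ K) :
    TuringLE (EmbedInfo K) zeroJump ∧
    (UniformlyFinite K → SetRecIn ∅ (EmbedInfo K)) := by
  have hd := hK.1.sigmaOne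
  obtain ⟨k₀, k₁, b₀, b₁, ⟨hk₀, hk₁, hb₀, hb₁⟩, hE⟩ :=
    exists_primrec_forall_mem_embedInfo_iff K
  have htup := (hd.tupleIn hk₀ hb₀).and (hd.tupleIn hk₁ hb₁)
  have hclash := hd.clash hk₀ hb₀ hk₁ hb₁
  constructor
  · exact turingLE_zeroJump_of_sigmaOne htup hclash hE
  · rintro ⟨⟨hR, hF⟩, f, -, hf⟩
    obtain ⟨F, hF⟩ := exists_list_forall_mem_iff hF
    obtain ⟨R, hR⟩ := exists_list_forall_mem_iff hR
    have hfin (i : ℕ) := (hf i _ (K.tup_mem i)).1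
    refine .of_sigmaOne ∅ ?_ ?_
    · have : SigmaOne fun p => (b₀ p).length = (b₁ p).length ∧
          ∃ D, IsIsoGraph F R (K.str (k₀ p)) (b₀ p) (K.str (k₁ p)) (b₁ p) D :=
        .and (.of_primrecPred (Primrec.eq.comp (by fun_prop) (by fun_prop)))
          (.exists_val (hd.isIsoGraph F R (by fun_prop) (by fun_prop) (by fun_prop)
            (by fun_prop) (by fun_prop)))
      refine (htup.and this).of_eq fun p => ?_
      rw [hE]
      refine and_congr_right fun h => ⟨fun ⟨hl, D, hD⟩ => hD.not_clash hl hF hR, fun hc =>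
        ⟨?_, exists_isIsoGraph h.1 h.2 hF hR (hf _ _ h.1).1 hc⟩⟩
      by_contra hl
      exact hc (.inl hl)
    · refine (((hd.not_tupleIn hF hfin hk₀ hb₀).or (hd.not_tupleIn hF hfin hk₁ hb₁)).or
        hclash).of_eq fun p => ?_
      rw [hE, not_and_or, not_not, not_and_or]

end CFL
end

section
/- Suppose M is a countable structure with s-computable domain which is s-computably ultrahomogeneous, for a Turing degree s. Then the canonical computable age 𝕂[M] has CAP(s). -/
/- Self-contained framework for computable ages and cofinal Fraïssé limits. -/

namespace CFL

open Classical

variable {L : Lang}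

/-! ### Finite oracles -/

open Nat.Partrec (Code)

/-- The finite partial oracle listed, in reverse order, by `σ`. -/
def finOracle (σ : List ℕ) : ℕ →. ℕ := fun n => (σ.reverse[n]? : Option ℕ)

/-- The first `m` values of `o`, in reverse order. -/
def initSeg (o : ℕ → ℕ) (m : ℕ) : List ℕ := ((List.range m).map o).reverse

theorem initSeg_succ (o : ℕ → ℕ) (m : ℕ) : initSeg o (m + 1) = o m :: initSeg o m := by
  simp [initSeg, List.range_succ]

theorem mem_finOracle_initSeg {o : ℕ → ℕ} {m n y : ℕ} :
    y ∈ finOracle (initSeg o m) n ↔ n < m ∧ o n = y := by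
  by_cases h : n < m <;> simp [finOracle, initSeg, h, eq_comm]

theorem exists_finOracle_code :
    ∃ l : Code, ∀ σ n, l.eval (Nat.pair (Encodable.encode σ) n) = finOracle σ n := by
  have h : Partrec (fun p : List ℕ × ℕ => finOracle p.1 p.2) :=
    (Primrec.list_getElem?.comp (Primrec.list_reverse.comp Primrec.fst)
      Primrec.snd).to_comp.ofOption
  obtain ⟨l, hl⟩ := Code.exists_code.1 h
  refine ⟨l, fun σ n => ?_⟩
  have : Nat.pair (Encodable.encode σ) n = Encodable.encode (σ, n) := rfl
  rw [hl, this]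
  simp [Part.bind_some, Part.map_id']

namespace OCode

/-- The oracle-free code obtained from an oracle code by answering the oracle queries with
the finite oracle `σ`, where `l` is a code of `finOracle`. -/
def compile (l : Code) (σ : List ℕ) : OCode → Code
  | zero => .zero
  | succ => .succ
  | left => .left
  | right => .right
  | oracle => l.curry (Encodable.encode σ)
  | pair a b => .pair (a.compile l σ) (b.compile l σ)
  | comp a b => .comp (a.compile l σ) (b.compile l σ)
  | prec a b => .prec (a.compile l σ) (b.compile l σ)
  | rfind' a => .rfind' (a.compile l σ)

theorem eval_compile {l : Code}
    (hl : ∀ σ n, l.eval (Nat.pair (Encodable.encode σ) n) = finOracle σ n)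
    (σ : List ℕ) (c : OCode) : (c.compile l σ).eval = c.eval (finOracle σ) := by
  induction c with
  | oracle => funext n; simp [compile, eval, Code.eval_curry, hl]
  | pair a b iha ihb => simp [compile, eval, Code.eval, iha, ihb]; rfl
  | comp a b iha ihb => simp [compile, eval, Code.eval, iha, ihb]; rfl
  | prec a b iha ihb => simp [compile, eval, Code.eval, iha, ihb]; rfl
  | rfind' a iha => simp [compile, eval, Code.eval, iha]; rfl
  | _ => rfl

/-- `compile`, as a function of the numerical code of an oracle code. -/
def compileIndex (l : Code) (σ : List ℕ) (e : ℕ) : Code :=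
  if e < 5 then
    ([Code.zero, Code.succ, Code.left, Code.right,
      l.curry (Encodable.encode σ)][e]?).getD Code.zero
  else
    ([Code.pair (compileIndex l σ ((e - 5) / 4).unpair.1)
        (compileIndex l σ ((e - 5) / 4).unpair.2),
      Code.comp (compileIndex l σ ((e - 5) / 4).unpair.1)
        (compileIndex l σ ((e - 5) / 4).unpair.2),
      Code.prec (compileIndex l σ ((e - 5) / 4).unpair.1)
        (compileIndex l σ ((e - 5) / 4).unpair.2),
      Code.rfind' (compileIndex l σ ((e - 5) / 4))][(e - 5) % 4]?).getD Code.zero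
termination_by e
decreasing_by
  all_goals
    have := Nat.unpair_left_le ((e - 5) / 4)
    have := Nat.unpair_right_le ((e - 5) / 4)
    omega

theorem compileIndex_encodeCode (l : Code) (σ : List ℕ) (c : OCode) :
    compileIndex l σ c.encodeCode = c.compile l σ := by
  induction c with
  | pair a b iha ihb =>
    have h : (4 * Nat.pair a.encodeCode b.encodeCode) / 4 =
      Nat.pair a.encodeCode b.encodeCode := by omega
    rw [compileIndex]; simp [encodeCode, compile, h, iha, ihb]
  | comp a b iha ihb =>
    have h : (4 * Nat.pair a.encodeCode b.encodeCode + 1) / 4 =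
      Nat.pair a.encodeCode b.encodeCode := by omega
    have h' : (4 * Nat.pair a.encodeCode b.encodeCode + 1) % 4 = 1 := by omega
    rw [compileIndex]; simp [encodeCode, compile, h, h', iha, ihb]
  | prec a b iha ihb =>
    have h : (4 * Nat.pair a.encodeCode b.encodeCode + 2) / 4 =
      Nat.pair a.encodeCode b.encodeCode := by omega
    have h' : (4 * Nat.pair a.encodeCode b.encodeCode + 2) % 4 = 2 := by omega
    rw [compileIndex]; simp [encodeCode, compile, h, h', iha, ihb]
  | rfind' a iha =>
    have h : (4 * a.encodeCode + 3) / 4 = a.encodeCode := by omega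
    have h' : (4 * a.encodeCode + 3) % 4 = 3 := by omega
    rw [compileIndex]; simp [encodeCode, compile, h, h', iha]
  | _ => rw [compileIndex]; simp [encodeCode, compile]

theorem primrec_compileIndex (l : Code) : Primrec₂ (compileIndex l) := by
  have hlen : Primrec fun p : List ℕ × List Code => p.2.length :=
    Primrec.list_length.comp Primrec.snd
  have hd : Primrec fun p : List ℕ × List Code => (p.2.length - 5) / 4 :=
    Primrec.nat_div.comp (Primrec.nat_sub.comp hlen (Primrec.const 5)) (Primrec.const 4)
  have hm : Primrec fun p : List ℕ × List Code => (p.2.length - 5) % 4 :=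
    Primrec.nat_mod.comp (Primrec.nat_sub.comp hlen (Primrec.const 5)) (Primrec.const 4)
  have hget {f : List ℕ × List Code → ℕ} (hf : Primrec f) :
      Primrec fun p => (p.2[f p]?).getD Code.zero :=
    Primrec.option_getD.comp (Primrec.list_getElem?.comp Primrec.snd hf) (Primrec.const _)
  have ha := hget (Primrec.fst.comp (Primrec.unpair.comp hd))
  have hb := hget (Primrec.snd.comp (Primrec.unpair.comp hd))
  have hr := hget hd
  have hbase := Primrec.option_getD.comp (Primrec.list_getElem?.comp
    (Primrec.list_cons.comp (Primrec.const Code.zero) <|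
      Primrec.list_cons.comp (Primrec.const Code.succ) <|
      Primrec.list_cons.comp (Primrec.const Code.left) <|
      Primrec.list_cons.comp (Primrec.const Code.right) <|
      Primrec.list_cons.comp (Code.primrec₂_curry.comp (Primrec.const l)
        (Primrec.encode.comp (Primrec.fst (α := List ℕ) (β := List Code))))
        (Primrec.const [])) hlen) (Primrec.const Code.zero)
  have hstep := Primrec.option_getD.comp (Primrec.list_getElem?.comp
    (Primrec.list_cons.comp (Code.primrec₂_pair.comp ha hb) <|
      Primrec.list_cons.comp (Code.primrec₂_comp.comp ha hb) <|
      Primrec.list_cons.comp (Code.primrec₂_prec.comp ha hb) <|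
      Primrec.list_cons.comp (Code.primrec_rfind'.comp hr) (Primrec.const [])) hm)
    (Primrec.const Code.zero)
  refine Primrec.nat_strong_rec _ (Primrec.option_some.comp
    (Primrec.ite (Primrec.nat_lt.comp hlen (Primrec.const 5)) hbase hstep)).to₂ ?_
  intro σ e
  have hval {x : ℕ} (hx : x < e) :
      (((List.range e).map (compileIndex l σ))[x]?).getD Code.zero = compileIndex l σ x := by
    simp [hx]
  rw [compileIndex]
  by_cases he : e < 5
  · simp [he]
  · have := Nat.unpair_left_le ((e - 5) / 4)
    have := Nat.unpair_right_le ((e - 5) / 4)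
    simp only [List.length_map, List.length_range, he, if_false]
    rw [hval (by omega), hval (by omega), hval (by omega)]

end OCode

/-- Evaluation of the oracle code with number `e` in `k` steps, relative to the finite
oracle `σ`. -/
def evalFin (l : Code) (k : ℕ) (σ : List ℕ) (e n : ℕ) : Option ℕ :=
  Code.evaln k (OCode.compileIndex l σ e) n

theorem primrec_evalFin {α : Type*} [Primcodable α] (l : Code) {k : α → ℕ} {σ : α → List ℕ}
    {e n : α → ℕ} (hk : Primrec k) (hσ : Primrec σ) (he : Primrec e) (hn : Primrec n) :
    Primrec fun a => evalFin l (k a) (σ a) (e a) (n a) :=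
  Code.primrec_evaln.comp ((hk.pair ((OCode.primrec_compileIndex l).comp hσ he)).pair hn)

open Filter in
/-- Evaluation is continuous in the oracle. -/
theorem OCode.eventually_mem_eval {ι : Type*} {F : Filter ι} {O : ℕ →. ℕ} {O' : ι → ℕ →. ℕ}
    (hO : ∀ n, ∀ y ∈ O n, ∀ᶠ i in F, y ∈ O' i n) (c : OCode) {n y : ℕ}
    (h : y ∈ c.eval O n) : ∀ᶠ i in F, y ∈ c.eval (O' i) n := by
  induction c generalizing n y with
  | oracle => exact hO n y h
  | pair a b iha ihb =>
    simp only [eval, Seq.seq, Part.map_eq_map, Part.mem_bind_iff, Part.mem_map_iff,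
      exists_exists_and_eq_and] at h ⊢
    obtain ⟨u, hu, v, hv, rfl⟩ := h
    filter_upwards [iha hu, ihb hv] with i hu hv
    exact ⟨u, hu, v, hv, rfl⟩
  | comp a b iha ihb =>
    obtain ⟨u, hu, hv⟩ := Part.mem_bind_iff.1 h
    filter_upwards [ihb hu, iha hv] with i hu hv
    exact Part.mem_bind_iff.2 ⟨u, hu, hv⟩
  | prec a b iha ihb =>
    simp only [eval, Nat.unpaired] at h ⊢
    generalize n.unpair.1 = p at *
    generalize n.unpair.2 = q at *
    induction q generalizing y with
    | zero => exact iha h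
    | succ q ih =>
      simp only [Part.bind_eq_bind, Part.mem_bind_iff] at h ih ⊢
      obtain ⟨u, hu, hv⟩ := h
      filter_upwards [ih hu, ihb hv] with i hu hv
      exact ⟨u, hu, hv⟩
  | rfind' a iha =>
    obtain ⟨u, hu, rfl⟩ := (Part.mem_map_iff _).1 h
    obtain ⟨hu, hlt⟩ := Nat.mem_rfind.1 hu
    obtain ⟨v, hv, hv0⟩ := (Part.mem_map_iff _).1 hu
    have hlt' : ∀ᶠ i in F, ∀ k ∈ Finset.range u,
        false ∈ (fun m => decide (m = 0)) <$>
          a.eval (O' i) (Nat.pair n.unpair.1 (k + n.unpair.2)) := by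
      rw [Filter.eventually_all_finset]
      intro k hk
      obtain ⟨v, hv, hv0⟩ := (Part.mem_map_iff _).1 (hlt (Finset.mem_range.1 hk))
      filter_upwards [iha hv] with i hv
      exact (Part.mem_map_iff _).2 ⟨v, hv, hv0⟩
    filter_upwards [iha hv, hlt'] with i hv hlt'
    exact (Part.mem_map_iff _).2 ⟨u, Nat.mem_rfind.2 ⟨(Part.mem_map_iff _).2 ⟨v, hv, hv0⟩,
      fun hk => hlt' _ (Finset.mem_range.2 hk)⟩, rfl⟩
  | _ => exact Eventually.of_forall fun _ => h

theorem OCode.mem_eval_mono {O O' : ℕ →. ℕ} (hO : ∀ n, ∀ y ∈ O n, y ∈ O' n) (c : OCode)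
    {n y : ℕ} (h : y ∈ c.eval O n) : y ∈ c.eval O' n :=
  Filter.eventually_const.1 <| c.eventually_mem_eval (F := (⊤ : Filter Unit))
    (O' := fun _ => O') (fun n y hy => Filter.eventually_const.2 (hO n y hy)) h

theorem mem_eval_of_evalFin {l : Code}
    (hl : ∀ σ n, l.eval (Nat.pair (Encodable.encode σ) n) = finOracle σ n)
    {o : ℕ → ℕ} {c : OCode} {k m n y : ℕ}
    (h : evalFin l k (initSeg o m) c.encodeCode n = some y) :
    y ∈ c.eval (fun n => Part.some (o n)) n := by
  rw [evalFin, OCode.compileIndex_encodeCode] at h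
  have h' := Code.evaln_sound (Option.mem_def.2 h)
  rw [OCode.eval_compile hl] at h'
  exact c.mem_eval_mono (fun n y hy => by simp [(mem_finOracle_initSeg.1 hy).2]) h'

theorem eventually_evalFin {l : Code}
    (hl : ∀ σ n, l.eval (Nat.pair (Encodable.encode σ) n) = finOracle σ n)
    {o : ℕ → ℕ} {c : OCode} {n y : ℕ} (h : y ∈ c.eval (fun n => Part.some (o n)) n) :
    ∀ᶠ p : ℕ × ℕ in Filter.atTop.curry Filter.atTop,
      evalFin l p.2 (initSeg o p.1) c.encodeCode n = some y := by
  have hmem : ∀ᶠ m in Filter.atTop, y ∈ c.eval (finOracle (initSeg o m)) n := by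
    refine c.eventually_mem_eval (fun n y hy => ?_) h
    filter_upwards [Filter.eventually_gt_atTop n] with m hm
    exact mem_finOracle_initSeg.2 ⟨hm, (Part.mem_some_iff.1 hy).symm⟩
  rw [Filter.eventually_curry_iff]
  filter_upwards [hmem] with m hm
  rw [← OCode.eval_compile hl, Code.evaln_complete] at hm
  obtain ⟨k₀, hk₀⟩ := hm
  filter_upwards [Filter.eventually_ge_atTop k₀] with k hk
  rw [evalFin, OCode.compileIndex_encodeCode]
  exact Code.evaln_mono hk hk₀

/-! ### Programming with oracle codes -/

namespace OCode

/-- An oracle-free code, as an oracle code. -/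
def ofCode : Code → OCode
  | .zero => zero
  | .succ => succ
  | .left => left
  | .right => right
  | .pair a b => pair (ofCode a) (ofCode b)
  | .comp a b => comp (ofCode a) (ofCode b)
  | .prec a b => prec (ofCode a) (ofCode b)
  | .rfind' a => rfind' (ofCode a)

theorem eval_ofCode (O : ℕ →. ℕ) (c : Code) : (ofCode c).eval O = c.eval := by
  induction c with
  | pair a b iha ihb => simp [ofCode, eval, Code.eval, iha, ihb]; rfl
  | comp a b iha ihb => simp [ofCode, eval, Code.eval, iha, ihb]; rfl
  | prec a b iha ihb => simp [ofCode, eval, Code.eval, iha, ihb]; rfl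
  | rfind' a iha => simp [ofCode, eval, Code.eval, iha]; rfl
  | _ => rfl

theorem eval_comp_of_eq_some {O : ℕ →. ℕ} {a b : OCode} {n y : ℕ}
    (h : b.eval O n = Part.some y) : (comp a b).eval O n = a.eval O y :=
  (congrArg (Part.bind · (a.eval O)) h).trans (Part.bind_some _ _)

end OCode

section TotalComputableIn

variable {s : Set ℕ} {f g : ℕ → ℕ}

theorem TotalComputableIn.of_primrec (hf : Primrec f) : TotalComputableIn s f := by
  obtain ⟨c, hc⟩ := Code.exists_code.1 (Nat.Partrec.of_primrec (Primrec.nat_iff.1 hf))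
  exact ⟨OCode.ofCode c, fun n => by rw [OCode.eval_ofCode, hc]; rfl⟩

theorem TotalComputableIn.comp (hf : TotalComputableIn s f) (hg : TotalComputableIn s g) :
    TotalComputableIn s fun n => f (g n) := by
  obtain ⟨a, ha⟩ := hf
  obtain ⟨b, hb⟩ := hg
  exact ⟨.comp a b, fun n => (OCode.eval_comp_of_eq_some (hb n)).trans (ha _)⟩

theorem TotalComputableIn.pair (hf : TotalComputableIn s f) (hg : TotalComputableIn s g) :
    TotalComputableIn s fun n => Nat.pair (f n) (g n) := by
  obtain ⟨a, ha⟩ := hf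
  obtain ⟨b, hb⟩ := hg
  exact ⟨.pair a b, fun n => by simp [OCode.eval, hb n, ha n, Seq.seq]⟩

/-- The total function underlying `chi`. -/
noncomputable def chiFun (s : Set ℕ) (n : ℕ) : ℕ := if n ∈ s then 1 else 0

theorem TotalComputableIn.initSeg_chiFun :
    TotalComputableIn s fun m => Encodable.encode (initSeg (chiFun s) m) := by
  have h : TotalComputableIn s fun n => n.unpair.2 :=
    .of_primrec (Primrec.snd.comp Primrec.unpair)
  have hO : TotalComputableIn s (chiFun s) := ⟨.oracle, fun n => rfl⟩
  have hy : TotalComputableIn s fun n => n.unpair.2.unpair.1 :=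
    .of_primrec (Primrec.fst.comp (Primrec.unpair.comp (Primrec.snd.comp Primrec.unpair)))
  obtain ⟨b, hb⟩ := (TotalComputableIn.of_primrec Primrec.succ).comp
    ((hO.comp hy).pair (h.comp h))
  have hprec : TotalComputableIn s fun n => Encodable.encode (initSeg (chiFun s) n.unpair.2) := by
    refine ⟨.prec .zero b, fun n => ?_⟩
    simp only [OCode.eval, Nat.unpaired]
    generalize n.unpair.2 = m
    induction m with
    | zero => rfl
    | succ m ih =>
      refine (congrArg (Part.bind · _) ih).trans ((Part.bind_some _ _).trans ((hb _).trans ?_))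
      simp [initSeg_succ]
  simpa using hprec.comp
    ((TotalComputableIn.of_primrec (Primrec.const 0)).pair (.of_primrec Primrec.id))

/-- Unbounded search for a witness of a property computable in `s`. -/
theorem exists_code_search (hf : TotalComputableIn s f) :
    ∃ c : OCode, ∀ p, (∃ t, f (Nat.pair p t) = 0) →
      ∃ t, f (Nat.pair p t) = 0 ∧ c.eval (chi s) p = Part.some t := by
  obtain ⟨a, ha⟩ := hf
  obtain ⟨b, hb⟩ := (TotalComputableIn.of_primrec Primrec.id).pair
    (TotalComputableIn.of_primrec (s := s) (Primrec.const 0))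
  refine ⟨.comp (.rfind' a) b, fun p hp => ⟨Nat.find hp, Nat.find_spec hp, ?_⟩⟩
  rw [OCode.eval_comp_of_eq_some (hb p), Part.eq_some_iff]
  refine (Part.mem_map_iff _).2 ⟨Nat.find hp, Nat.mem_rfind.2 ⟨?_, fun {m} hm => ?_⟩, by simp⟩
  · simp [ha _, Nat.find_spec hp]
  · simpa [ha _] using Nat.find_min hp hm

/-- A search through finite approximations of the oracle. -/
theorem exists_code_search_initSeg {q : List ℕ → ℕ → ℕ → Option ℕ}
    (hq : Primrec fun a : List ℕ × ℕ × ℕ => q a.1 a.2.1 a.2.2) :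
    ∃ c : OCode, ∀ p, (∃ m w, (q (initSeg (chiFun s) m) p w).isSome) →
      ∃ m w v, q (initSeg (chiFun s) m) p w = some v ∧ c.eval (chi s) p = Part.some v := by
  let F : ℕ → ℕ := fun n =>
    Encodable.encode (q (initSeg (chiFun s) n.unpair.2.unpair.1) n.unpair.1 n.unpair.2.unpair.2)
  have h1 : Primrec fun n : ℕ => n.unpair.1 := Primrec.fst.comp Primrec.unpair
  have h2 : Primrec fun n : ℕ => n.unpair.2 := Primrec.snd.comp Primrec.unpair
  let Q : ℕ → ℕ := fun n => Encodable.encode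
    (q ((Encodable.decode (α := List ℕ) n.unpair.1).getD []) n.unpair.2.unpair.1
      n.unpair.2.unpair.2)
  have hQ : Primrec Q := Primrec.encode.comp <| hq.comp <|
    (Primrec.option_getD.comp (Primrec.decode.comp h1) (Primrec.const [])).pair <|
    (h1.comp h2).pair (h2.comp h2)
  have hF : TotalComputableIn s F := by
    have := (TotalComputableIn.of_primrec (s := s) hQ).comp
      ((TotalComputableIn.initSeg_chiFun.comp (.of_primrec (h1.comp h2))).pair
        ((TotalComputableIn.of_primrec h1).pair (.of_primrec (h2.comp h2))))
    simpa [Q, F] using this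
  obtain ⟨a, ha⟩ := exists_code_search ((TotalComputableIn.of_primrec
    (Primrec.nat_sub.comp (Primrec.const 1) Primrec.id)).comp hF)
  obtain ⟨b, hb⟩ := (TotalComputableIn.of_primrec Primrec.pred).comp hF
  obtain ⟨i, hi⟩ := TotalComputableIn.of_primrec (s := s) Primrec.id
  refine ⟨.comp b (.pair i a), fun p ⟨m, w, h⟩ => ?_⟩
  obtain ⟨v, hv⟩ := Option.isSome_iff_exists.1 h
  obtain ⟨t, ht, hat⟩ := ha p ⟨Nat.pair m w, by simp [F, hv]⟩
  cases hq' : q (initSeg (chiFun s) t.unpair.1) p t.unpair.2 with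
  | none => simp [F, hq'] at ht
  | some v =>
    refine ⟨_, _, v, hq', ?_⟩
    have hpair : (OCode.pair i a).eval (chi s) p = Part.some (Nat.pair p t) := by
      simp [OCode.eval, hat, hi p, Seq.seq]
    rw [OCode.eval_comp_of_eq_some hpair, hb]
    simp [F, hq']

end TotalComputableIn

/-! ### The amalgamation procedure -/

theorem eq_of_evalFin_chi {l : Code}
    (hl : ∀ σ n, l.eval (Nat.pair (Encodable.encode σ) n) = finOracle σ n)
    {s : Set ℕ} {c : OCode} {n y k m v : ℕ} (h : c.eval (chi s) n = Part.some y)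
    (hv : evalFin l k (initSeg (chiFun s) m) c.encodeCode n = some v) : v = y := by
  have : v ∈ c.eval (chi s) n := mem_eval_of_evalFin hl hv
  simpa [h] using this

theorem eventually_evalFin_chi {l : Code}
    (hl : ∀ σ n, l.eval (Nat.pair (Encodable.encode σ) n) = finOracle σ n)
    {s : Set ℕ} {c : OCode} {n y : ℕ} (h : c.eval (chi s) n = Part.some y) :
    ∀ᶠ a : ℕ × ℕ in Filter.atTop.curry Filter.atTop,
      evalFin l a.2 (initSeg (chiFun s) a.1) c.encodeCode n = some y :=
  eventually_evalFin hl (Part.eq_some_iff.1 h)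

/-- Coordinatewise application of `evalFin` to a tuple. -/
def mapFin (l : Code) (k : ℕ) (σ : List ℕ) (e : ℕ) (L : List ℕ) : Option (List ℕ) :=
  L.foldr (fun x t => t.bind fun t => (evalFin l k σ e x).map fun y => y :: t) (some [])

theorem primrec_mapFin {α : Type*} [Primcodable α] (l : Code) {k : α → ℕ} {σ : α → List ℕ}
    {e : α → ℕ} {L : α → List ℕ} (hk : Primrec k) (hσ : Primrec σ) (he : Primrec e)
    (hL : Primrec L) : Primrec fun a => mapFin l (k a) (σ a) (e a) (L a) := by
  refine Primrec.list_foldr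
    (h := fun a (b : ℕ × Option (List ℕ)) =>
      b.2.bind fun t => (evalFin l (k a) (σ a) (e a) b.1).map fun y => y :: t)
    hL (Primrec.const (some [])) ?_
  refine Primrec.option_bind (Primrec.snd.comp Primrec.snd) ?_
  have h : Primrec fun q : (α × ℕ × Option (List ℕ)) × List ℕ => q.1.1 :=
    Primrec.fst.comp Primrec.fst
  exact Primrec.option_map
    (primrec_evalFin l (hk.comp h) (hσ.comp h) (he.comp h)
      (Primrec.fst.comp (Primrec.snd.comp Primrec.fst)))
    (Primrec.list_cons.comp Primrec.snd (Primrec.snd.comp Primrec.fst)).to₂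

theorem mapFin_eq {l : Code}
    (hl : ∀ σ n, l.eval (Nat.pair (Encodable.encode σ) n) = finOracle σ n)
    {s : Set ℕ} {c : OCode} {g : ℕ → ℕ} (hc : ComputesIn s c g) {k m : ℕ} {L L' : List ℕ}
    (h : mapFin l k (initSeg (chiFun s) m) c.encodeCode L = some L') : L' = L.map g := by
  induction L generalizing L' with
  | nil => simpa [mapFin] using h.symm
  | cons x L ih =>
    obtain ⟨t, ht, h⟩ := Option.bind_eq_some_iff.1 h
    obtain ⟨y, hy, rfl⟩ := Option.map_eq_some_iff.1 h
    rw [ih ht, eq_of_evalFin_chi hl (hc x) hy, List.map_cons]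

theorem eventually_mapFin {l : Code}
    (hl : ∀ σ n, l.eval (Nat.pair (Encodable.encode σ) n) = finOracle σ n)
    {s : Set ℕ} {c : OCode} {g : ℕ → ℕ} (hc : ComputesIn s c g) (L : List ℕ) :
    ∀ᶠ a : ℕ × ℕ in Filter.atTop.curry Filter.atTop,
      mapFin l a.2 (initSeg (chiFun s) a.1) c.encodeCode L = some (L.map g) := by
  induction L with
  | nil => exact Filter.Eventually.of_forall fun _ => rfl
  | cons x L ih =>
    filter_upwards [ih, eventually_evalFin_chi hl (hc x)] with a ha hx
    exact Option.bind_eq_some_iff.2 ⟨_, ha, by simp [hx]⟩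

/-- The list of natural numbers with a given code. -/
def decodeList (n : ℕ) : List ℕ := (Encodable.decode (α := List ℕ) n).getD []

theorem decodeList_encode (t : List ℕ) : decodeList (Encodable.encode t) = t := by
  simp [decodeList]

theorem primrec_decodeList : Primrec decodeList :=
  Primrec.option_getD.comp Primrec.decode (Primrec.const [])

/-- The amalgamation procedure on the code `p` of a potential span, where `cK` and `cU` are
(numbers of) programs for the enumeration of the tuples and for ultrahomogeneity. The number
`w` codes a bound on the number of steps and a guess for the index of the amalgam. -/
def amalgFin (l : Code) (cK cU : ℕ) (σ : List ℕ) (p w : ℕ) : Option ℕ :=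
  (evalFin l w.unpair.1 σ cK p.unpair.1.unpair.2.unpair.1).bind fun t₀ =>
  (evalFin l w.unpair.1 σ cK p.unpair.2.unpair.2.unpair.1).bind fun t₁ =>
  (evalFin l w.unpair.1 σ cU
    (Nat.pair p.unpair.2.unpair.2.unpair.2 p.unpair.1.unpair.2.unpair.2)).bind fun e =>
  (mapFin l w.unpair.1 σ e (decodeList t₁)).bind fun u =>
  if evalFin l w.unpair.1 σ cK w.unpair.2 = some (Encodable.encode (decodeList t₀ ++ u)) then
    some (Nat.pair (Nat.pair p.unpair.1.unpair.2.unpair.1 (Nat.pair w.unpair.2 t₀))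
      (Nat.pair p.unpair.2.unpair.2.unpair.1 (Nat.pair w.unpair.2 (Encodable.encode u))))
  else none

theorem primrec_amalgFin (l : Code) (cK cU : ℕ) :
    Primrec fun a : List ℕ × ℕ × ℕ => amalgFin l cK cU a.1 a.2.1 a.2.2 := by
  have un₁ : Primrec fun n : ℕ => n.unpair.1 := Primrec.fst.comp Primrec.unpair
  have un₂ : Primrec fun n : ℕ => n.unpair.2 := Primrec.snd.comp Primrec.unpair
  have hσ : Primrec fun a : List ℕ × ℕ × ℕ => a.1 := Primrec.fst
  have hp : Primrec fun a : List ℕ × ℕ × ℕ => a.2.1 := Primrec.fst.comp Primrec.snd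
  have hw : Primrec fun a : List ℕ × ℕ × ℕ => a.2.2 := Primrec.snd.comp Primrec.snd
  have hk := un₁.comp hw
  have hg := un₂.comp hw
  have hj₀ := un₁.comp (un₂.comp (un₁.comp hp))
  have hc₀ := un₂.comp (un₂.comp (un₁.comp hp))
  have hj₁ := un₁.comp (un₂.comp (un₂.comp hp))
  have hc₁ := un₂.comp (un₂.comp (un₂.comp hp))
  have π₁ : Primrec fun a : (List ℕ × ℕ × ℕ) × ℕ => a.1 := Primrec.fst
  have π₂ := π₁.comp (Primrec.fst (α := (List ℕ × ℕ × ℕ) × ℕ) (β := ℕ))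
  have π₃ := π₂.comp (Primrec.fst (α := ((List ℕ × ℕ × ℕ) × ℕ) × ℕ) (β := ℕ))
  have π₄ := π₃.comp (Primrec.fst (α := (((List ℕ × ℕ × ℕ) × ℕ) × ℕ) × ℕ) (β := List ℕ))
  have ht₀ : Primrec fun a : ((((List ℕ × ℕ × ℕ) × ℕ) × ℕ) × ℕ) × List ℕ => a.1.1.1.2 :=
    Primrec.snd.comp (Primrec.fst.comp (Primrec.fst.comp Primrec.fst))
  have hu : Primrec fun a : ((((List ℕ × ℕ × ℕ) × ℕ) × ℕ) × ℕ) × List ℕ => a.2 :=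
    Primrec.snd
  refine Primrec.option_bind (primrec_evalFin l hk hσ (Primrec.const cK) hj₀) ?_
  refine Primrec.option_bind
    (primrec_evalFin l (hk.comp π₁) (hσ.comp π₁) (Primrec.const cK) (hj₁.comp π₁)) ?_
  refine Primrec.option_bind
    (primrec_evalFin l (hk.comp π₂) (hσ.comp π₂) (Primrec.const cU)
      (Primrec₂.natPair.comp (hc₁.comp π₂) (hc₀.comp π₂))) ?_
  refine Primrec.option_bind
    (primrec_mapFin l (hk.comp π₃) (hσ.comp π₃) Primrec.snd
      (primrec_decodeList.comp (Primrec.snd.comp Primrec.fst))) ?_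
  exact Primrec.ite
    (Primrec.eq.comp
      (primrec_evalFin l (hk.comp π₄) (hσ.comp π₄) (Primrec.const cK) (hg.comp π₄))
      (Primrec.option_some.comp <| Primrec.encode.comp <|
        Primrec.list_append.comp (primrec_decodeList.comp ht₀) hu))
    (Primrec.option_some.comp <| Primrec₂.natPair.comp
      (Primrec₂.natPair.comp (hj₀.comp π₄) (Primrec₂.natPair.comp (hg.comp π₄) ht₀))
      (Primrec₂.natPair.comp (hj₁.comp π₄)
        (Primrec₂.natPair.comp (hg.comp π₄) (Primrec.encode.comp hu))))
    (Primrec.const none)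

/-- Let `tup` be an `s`-computable enumeration of tuples and let `c` compute numbers of
programs for total functions `g` in `s`. Then an index `k` with
`tup k = tup j₀ ++ (tup j₁).map g` can be found `s`-computably, if there is one. -/
theorem exists_code_amalg {s : Set ℕ} {tup : ℕ → List ℕ}
    (htup : TotalComputableIn s fun i => Encodable.encode (tup i)) (c : OCode) :
    ∃ a : OCode, ∀ (i₀ j₀ i₁ j₁ : ℕ) (c₀ c₁ : List ℕ) (c' : OCode) (g : ℕ → ℕ),
      c.eval (chi s) (Nat.pair (Encodable.encode c₁) (Encodable.encode c₀)) =
        Part.some c'.encodeCode → ComputesIn s c' g →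
      (∃ k, tup k = tup j₀ ++ (tup j₁).map g) →
      ∃ k, tup k = tup j₀ ++ (tup j₁).map g ∧
        a.eval (chi s) (Nat.pair (PotEmb.code ⟨i₀, j₀, c₀⟩) (PotEmb.code ⟨i₁, j₁, c₁⟩)) =
          Part.some (Nat.pair (PotEmb.code ⟨j₀, k, tup j₀⟩)
            (PotEmb.code ⟨j₁, k, (tup j₁).map g⟩)) := by
  obtain ⟨l, hl⟩ := exists_finOracle_code
  obtain ⟨b, hb⟩ := htup
  obtain ⟨a, ha⟩ := exists_code_search_initSeg (s := s)
    (primrec_amalgFin l b.encodeCode c.encodeCode)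
  refine ⟨a, fun i₀ j₀ i₁ j₁ c₀ c₁ c' g hc hc' ⟨k₀, hk₀⟩ => ?_⟩
  obtain ⟨m, w, v, hv, hav⟩ := ha
    (Nat.pair (PotEmb.code ⟨i₀, j₀, c₀⟩) (PotEmb.code ⟨i₁, j₁, c₁⟩)) <| by
    have hev := (eventually_evalFin_chi hl (hb j₀)).and <|
      (eventually_evalFin_chi hl (hb j₁)).and <|
      (eventually_evalFin_chi hl hc).and <|
      (eventually_mapFin hl hc' (tup j₁)).and (eventually_evalFin_chi hl (hb k₀))
    obtain ⟨m, hm⟩ := (Filter.eventually_curry_iff.1 hev).exists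
    obtain ⟨k, h₁, h₂, h₃, h₄, h₅⟩ := hm.exists
    refine ⟨m, Nat.pair k k₀, ?_⟩
    simp [amalgFin, PotEmb.code, h₁, h₂, h₃, h₄, h₅, decodeList_encode, hk₀]
  simp only [amalgFin, PotEmb.code, Nat.unpair_pair] at hv
  obtain ⟨t₀, h₀, hv⟩ := Option.bind_eq_some_iff.1 hv
  obtain ⟨t₁, h₁, hv⟩ := Option.bind_eq_some_iff.1 hv
  obtain ⟨e, he, hv⟩ := Option.bind_eq_some_iff.1 hv
  obtain ⟨u, hu, hv⟩ := Option.bind_eq_some_iff.1 hv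
  obtain rfl := eq_of_evalFin_chi hl (hb j₀) h₀
  obtain rfl := eq_of_evalFin_chi hl (hb j₁) h₁
  obtain rfl := eq_of_evalFin_chi hl hc he
  obtain rfl := mapFin_eq hl hc' hu
  simp only [decodeList_encode, Option.ite_none_right_eq_some, Option.some.injEq] at hv
  obtain ⟨hk, rfl⟩ := hv
  exact ⟨w.unpair.2, (Encodable.encode_injective (eq_of_evalFin_chi hl (hb _) hk)).symm,
    hav⟩

/-! ### Generated substructures -/

theorem InClosure.of_mem {A : Str L} {s : List ℕ} (hs : TupleIn A s) {x : ℕ} (hx : x ∈ s) :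
    InClosure A s x :=
  .base hx (hs x hx)

theorem InClosure.trans {A : Str L} {s t : List ℕ} (hs : ∀ x ∈ s, InClosure A t x) {x : ℕ}
    (h : InClosure A s x) : InClosure A t x := by
  induction h with
  | base hx _ => exact hs _ hx
  | fn f as ha _ ih => exact .fn f as ha ih

theorem inClosure_sub_iff {A : Str L} {s t : List ℕ} (hs : TupleIn (A.sub t) s) {x : ℕ} :
    InClosure (A.sub t) s x ↔ InClosure A s x := by
  constructor <;> intro h
  · induction h with
    | base hx hd => exact .base hx (InClosure.mem_dom hd)
    | fn f as ha _ ih => exact .fn f as ha ih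
  · induction h with
    | base hx _ => exact .base hx (hs _ hx)
    | fn f as ha _ ih => exact InClosure.fn (A := A.sub t) f as ha ih

theorem Str.sub_sub {A : Str L} {s t : List ℕ} (hs : TupleIn (A.sub t) s) :
    (A.sub t).sub s = A.sub s := by
  have h : ∀ x, InClosure (A.sub t) s x ↔ InClosure A s x := fun x => inClosure_sub_iff hs
  simp only [Str.sub, Str.mk.injEq, and_true] at h ⊢
  refine ⟨Set.ext h, ?_⟩
  funext r as
  refine propext ⟨fun hr => ⟨hr.1.1, fun x hx => (h x).1 (hr.2 x hx)⟩, fun hr =>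
    ⟨⟨hr.1, fun x hx => (hr.2 x hx).trans hs⟩, fun x hx => (h x).2 (hr.2 x hx)⟩⟩

theorem clSim_sub_iff {A B : Str L} {s t u v : List ℕ} (hu : TupleIn (A.sub s) u)
    (hv : TupleIn (B.sub t) v) : ClSim (A.sub s) u (B.sub t) v ↔ ClSim A u B v := by
  simp only [ClSim, Str.sub_sub hu, Str.sub_sub hv]

theorem tupleIn_sub_self {A : Str L} {s : List ℕ} (hs : TupleIn A s) : TupleIn (A.sub s) s :=
  fun _ hx => .of_mem hs hx

/-! ### Isomorphisms of generated substructures -/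

theorem IsIsoMap.comp {A B C : Str L} {h h' : ℕ → ℕ} (hh : IsIsoMap A B h)
    (hh' : IsIsoMap B C h') : IsIsoMap A C (h' ∘ h) := by
  obtain ⟨⟨hd, hi, hr, hf⟩, hs⟩ := hh
  obtain ⟨⟨hd', hi', hr', hf'⟩, hs'⟩ := hh'
  have ht {as : List ℕ} (ha : TupleIn A as) : TupleIn B (as.map h) := by
    simpa [TupleIn] using fun x hx => hd x (ha x hx)
  refine ⟨⟨fun x hx => hd' _ (hd x hx),
    fun x hx y hy e => hi x hx y hy (hi' _ (hd x hx) _ (hd y hy) e), fun r as ha => ?_,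
    fun f as hl ha => ?_⟩, fun z hz => ?_⟩
  · rw [hr r as ha, hr' r _ (ht ha), List.map_map]
  · rw [Function.comp, hf f as hl ha, hf' f _ (by simpa using hl) (ht ha), List.map_map]
  · obtain ⟨y, hy, rfl⟩ := hs' z hz
    obtain ⟨x, hx, rfl⟩ := hs y hy
    exact ⟨x, hx, rfl⟩

theorem IsIsoMap.symm {A B : Str L} {h h' : ℕ → ℕ} (hh : IsIsoMap A B h)
    (hl : ∀ x ∈ A.dom, h' (h x) = x) : IsIsoMap B A h' := by
  obtain ⟨⟨hd, hi, hr, hf⟩, hs⟩ := hh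
  have hmem : ∀ y ∈ B.dom, h' y ∈ A.dom := fun y hy => by
    obtain ⟨x, hx, rfl⟩ := hs y hy
    rwa [hl x hx]
  have hinv : ∀ y ∈ B.dom, h (h' y) = y := fun y hy => by
    obtain ⟨x, hx, rfl⟩ := hs y hy
    rw [hl x hx]
  have ht {bs : List ℕ} (hb : TupleIn B bs) : TupleIn A (bs.map h') := by
    simpa [TupleIn] using fun x hx => hmem x (hb x hx)
  have hmap {bs : List ℕ} (hb : TupleIn B bs) : (bs.map h').map h = bs := by
    rw [List.map_map]
    exact (List.map_congr_left fun y hy => hinv y (hb y hy)).trans (List.map_id _)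
  refine ⟨⟨hmem, fun x hx y hy e => by rw [← hinv x hx, e, hinv y hy], fun r bs hb => ?_,
    fun f bs hlen hb => ?_⟩, fun x hx => ⟨h x, hd x hx, hl x hx⟩⟩
  · rw [hr r _ (ht hb), hmap hb]
  · have hlen' : L.funArity f = some (bs.map h').length := by simpa using hlen
    rw [← hl _ (A.fn_mem f _ hlen' (ht hb)), hf f _ hlen' (ht hb), hmap hb]

theorem ClSim.symm {A B : Str L} {as bs : List ℕ} (ha : TupleIn A as)
    (h : ClSim A as B bs) : ClSim B bs A as := by
  obtain ⟨h, rfl, hh⟩ := h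
  have hl : ∀ x ∈ (A.sub as).dom, Function.invFunOn h (A.sub as).dom (h x) = x :=
    Set.InjOn.leftInvOn_invFunOn fun x hx y hy => hh.1.2.1 x hx y hy
  refine ⟨_, ?_, hh.symm hl⟩
  rw [List.map_map]
  exact (List.map_congr_left fun x hx => hl x (.of_mem ha hx)).trans (List.map_id _)

theorem ClSim.trans {A B C : Str L} {as bs cs : List ℕ} (h : ClSim A as B bs)
    (h' : ClSim B bs C cs) : ClSim A as C cs := by
  obtain ⟨h, rfl, hh⟩ := h
  obtain ⟨h', rfl, hh'⟩ := h'
  exact ⟨h' ∘ h, by rw [List.map_map], hh.comp hh'⟩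

theorem ClSim.refl (A : Str L) (as : List ℕ) : ClSim A as A as :=
  ⟨id, List.map_id _, ⟨fun _ h => h, fun _ _ _ _ h => h, fun _ _ _ => by rw [List.map_id],
    fun _ _ _ _ => by rw [List.map_id, id]⟩, fun y hy => ⟨y, hy, rfl⟩⟩

theorem IsEmbMap.inClosure_map {A B : Str L} {h : ℕ → ℕ} (hh : IsEmbMap A B h) {s : List ℕ}
    {x : ℕ} (hx : InClosure A s x) : InClosure B (s.map h) (h x) := by
  induction hx with
  | base hx hd => exact .base (List.mem_map_of_mem hx) (hh.1 _ hd)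
  | fn f as ha hm ih =>
    rw [hh.2.2.2 f as ha fun x hx => (hm x hx).mem_dom]
    exact .fn f _ (by simpa using ha) (by simpa using ih)

theorem IsEmbMap.exists_inClosure {A B : Str L} {h : ℕ → ℕ} (hh : IsEmbMap A B h)
    {s : List ℕ} (hs : TupleIn A s) {y : ℕ} (hy : InClosure B (s.map h) y) :
    ∃ x, InClosure A s x ∧ h x = y := by
  induction hy with
  | base hy _ =>
    obtain ⟨x, hx, rfl⟩ := List.mem_map.1 hy
    exact ⟨x, .of_mem hs hx, rfl⟩
  | fn f bs hb _ ih =>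
    choose! k hk hk' using ih
    have hmap : (bs.map k).map h = bs := by
      rw [List.map_map]
      exact (List.map_congr_left hk').trans (List.map_id _)
    have hcl : ∀ x ∈ bs.map k, InClosure A s x := by simpa using hk
    have hlen : L.funArity f = some (bs.map k).length := by simpa using hb
    exact ⟨_, .fn f _ hlen hcl,
      by rw [hh.2.2.2 f _ hlen fun x hx => (hcl x hx).mem_dom, hmap]⟩

theorem IsEmbMap.clSim_map {A B : Str L} {h : ℕ → ℕ} (hh : IsEmbMap A B h) {s : List ℕ}
    (hs : TupleIn A s) : ClSim A s B (s.map h) := by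
  have hd {as : List ℕ} (ha : TupleIn (A.sub s) as) : TupleIn A as :=
    fun x hx => (ha x hx).mem_dom
  refine ⟨h, rfl, ⟨fun x hx => hh.inClosure_map hx,
    fun x hx y hy => hh.2.1 x hx.mem_dom y hy.mem_dom, fun r as ha => ?_,
    fun f as hl ha => hh.2.2.2 f as hl (hd ha)⟩, fun y hy => hh.exists_inClosure hs hy⟩
  have hr := hh.2.2.1 r as (hd ha)
  refine ⟨fun h => ⟨hr.1 h.1, ?_⟩, fun h => ⟨hr.2 h.1, ha⟩⟩
  simpa using fun x hx => hh.inClosure_map (ha x hx)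

/-- Embeddings of a generated substructure which agree on the generators are equal. -/
theorem eqOn_inClosure {A : Str L} {s : List ℕ} {h h' : ℕ → ℕ} {fn : ℕ → List ℕ → ℕ}
    (hh : ∀ f as, L.funArity f = some as.length → TupleIn (A.sub s) as →
      h (A.fn f as) = fn f (as.map h))
    (hh' : ∀ f as, L.funArity f = some as.length → TupleIn (A.sub s) as →
      h' (A.fn f as) = fn f (as.map h'))
    (hs : s.map h = s.map h') {x : ℕ} (hx : InClosure A s x) : h x = h' x := by
  induction hx with
  | base hx _ => exact List.map_inj_left.1 hs _ hx
  | fn f as ha hm ih => rw [hh f as ha hm, hh' f as ha hm, List.map_congr_left ih]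

theorem isEmb_iff_of_canonical {t : Set ℕ} {K : CompAge L} {M : Str L}
    (hK : IsCanonicalAgeOf t K M) {F : PotEmb} (hF : F.Valid K) :
    F.IsEmb K ↔ ClSim M (K.tup F.i) M F.c := by
  obtain ⟨-, hmem, -, hstr⟩ := hK
  have hc := hF.2
  rw [hstr] at hc
  rw [PotEmb.IsEmb, hstr, hstr]
  exact clSim_sub_iff (tupleIn_sub_self (hmem _)) hc

/-- If `M` is a countable structure with `s`-computable domain which is
`s`-computably ultrahomogeneous, then its canonical age has `CAP(s)`. -/
theorem comp_ultrahom_implies_CAP {L : Lang} (hL : L.ComputableRep)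
    (s : Set ℕ) (M : Str L)
    (hdom : SetRecIn s M.dom) (hu : CompUltrahom s M) :
    ∀ K : CompAge L, IsCanonicalAgeOf s K M → CAP s K := by
  intro K hK
  obtain ⟨htup, hmem, hall, hstr⟩ := id hK
  obtain ⟨c, hc⟩ := hu
  obtain ⟨a, ha⟩ := exists_code_amalg htup c
  refine ⟨a, ?_⟩
  rintro ⟨i, j₀, c₀⟩ ⟨i₁, j₁, c₁⟩ ⟨hF₀, hF₁, rfl : i = i₁⟩
  have hc₀ : ∀ x ∈ c₀, InClosure M (K.tup j₀) x := by
    have h := hF₀.2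
    rwa [hstr] at h
  have hc₁ : ∀ x ∈ c₁, InClosure M (K.tup j₁) x := by
    have h := hF₁.2
    rwa [hstr] at h
  have hm₀ : TupleIn M c₀ := fun x hx => (hc₀ x hx).mem_dom
  have hm₁ : TupleIn M c₁ := fun x hx => (hc₁ x hx).mem_dom
  obtain ⟨_, he, c', rfl, g, hg, hbij, hauto⟩ := hc c₁ c₀ hm₁ hm₀ (hF₁.1.trans hF₀.1.symm)
  have hgt : TupleIn M ((K.tup j₁).map g) := by
    simpa [TupleIn] using fun x hx => hbij.1 x (hmem j₁ x hx)
  obtain ⟨k₀, -, hk₀⟩ := hall (K.tup j₀ ++ (K.tup j₁).map g)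
    (fun x hx => (List.mem_append.1 hx).elim (hmem j₀ x) (hgt x)) 0
  obtain ⟨k, hk, hak⟩ := ha i j₀ i j₁ c₀ c₁ c' g he hg ⟨k₀, hk₀⟩
  have hG₀ : PotEmb.Valid K ⟨j₀, k, K.tup j₀⟩ := by
    refine ⟨rfl, ?_⟩
    simp only [hstr]
    exact fun x hx => .base (by simp [hk, hx]) (hmem j₀ x hx)
  have hG₁ : PotEmb.Valid K ⟨j₁, k, (K.tup j₁).map g⟩ := by
    refine ⟨List.length_map _, ?_⟩
    simp only [hstr]
    exact fun x hx => .base (by rw [hk]; exact List.mem_append_right _ hx) (hgt x hx)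
  refine ⟨_, _, hak, hG₀, hG₁, (isEmb_iff_of_canonical hK hG₀).2 (.refl _ _), rfl, rfl, rfl,
    fun h₀ h₁ => ?_⟩
  rw [isEmb_iff_of_canonical hK hF₀] at h₀
  rw [isEmb_iff_of_canonical hK hF₁] at h₁
  obtain ⟨hga, hgc⟩ := hauto ((h₁.symm (hmem i)).trans h₀)
  refine ⟨(isEmb_iff_of_canonical hK hG₁).2 (hga.1.clSim_map (hmem j₁)), ?_⟩
  rintro f₀ f₁ ⟨hf₀, hf₀'⟩ ⟨hf₁, hf₁'⟩
  simp only [hstr] at hf₀ hf₁ hf₀' hf₁'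
  have e₀ : ∀ x ∈ c₀, f₀ x = x := fun x hx =>
    eqOn_inClosure (h' := id) hf₀'.2.2.2 (fun f as _ _ => by rw [List.map_id]; rfl)
      (by rw [hf₀, List.map_id]) (hc₀ x hx)
  have e₁ : ∀ x ∈ c₁, f₁ x = g x := fun x hx =>
    eqOn_inClosure hf₁'.2.2.2
      (fun f as hl has => hga.1.2.2.2 f as hl fun x hx => (has x hx).mem_dom) hf₁ (hc₁ x hx)
  exact (List.map_congr_left e₀).trans <| (List.map_id' _).trans <|
    hgc.symm.trans (List.map_congr_left e₁).symm

end CFL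
end
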